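/- arXiv:1802.05724 — 2 statements merged into one kernel-verified Lean document; each statement's English description precedes it below -/
import Mathlib

section
/- Let p>1, Q>1, p1 = -1/(p-1), and let q₀ = 1/s⁺_{p1}(Q). Then on the real line with Lebesgue measure the range 1 ≤ q < q₀ in the inclusion A_p ⊂ RH_q is sharp: there exists a weight w on ℝ with [w]_p = Q and [w]_{RH_{q₀}} = ∞, i.e. w ∉ RH_{q₀}. -/
open MeasureTheory Set Filter

noncomputable section

/-- Average of `f` over the interval `(a,b)` with respect to Lebesgue measure. -/
def intAvg (a b : ℝ) (f : ℝ → ℝ) : ℝ := ⨍ x in Ioo a b, f x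

/-- The `A_p` characteristic quantity `⟨w⟩_I ⟨w^{-1/(p-1)}⟩_I^{p-1}` of `w` on `I = (a,b)`. -/
def ApChar (w : ℝ → ℝ) (p a b : ℝ) : ℝ :=
  intAvg a b w * (intAvg a b fun x => w x ^ (-1 / (p - 1))) ^ (p - 1)

/-- The `RH_p` characteristic quantity `⟨w^p⟩_I^{1/p} ⟨w⟩_I^{-1}` of `w` on `I = (a,b)`. -/
def RHChar (w : ℝ → ℝ) (p a b : ℝ) : ℝ :=
  (intAvg a b fun x => w x ^ p) ^ (1 / p) * (intAvg a b w)⁻¹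

/-- `[w]_p ≤ C` on the real line (with the requisite integrability on every interval). -/
def MemAp (w : ℝ → ℝ) (p C : ℝ) : Prop :=
  ∀ a b : ℝ, a < b →
    IntegrableOn w (Ioo a b) ∧ IntegrableOn (fun x => w x ^ (-1 / (p - 1))) (Ioo a b) ∧
    ApChar w p a b ≤ C

/-- `[w]_{RH_p} ≤ C` on the real line (with the requisite integrability on every interval). -/
def MemRH (w : ℝ → ℝ) (p C : ℝ) : Prop :=
  ∀ a b : ℝ, a < b →
    IntegrableOn w (Ioo a b) ∧ IntegrableOn (fun x => w x ^ p) (Ioo a b) ∧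
    RHChar w p a b ≤ C

/-! ### Periodic functions and insertion of constant strips -/

theorem Function.Periodic.intervalIntegral_sub_int_mul {g : ℝ → ℝ} {T : ℝ}
    (hg : Function.Periodic g T) (k : ℤ) (s t : ℝ) :
    ∫ x in (s - k * T)..(t - k * T), g x = ∫ x in s..t, g x := by
  rw [← intervalIntegral.integral_comp_sub_right (fun x => g x) (k * T)]
  simp only [hg.sub_int_mul_eq k]

theorem Function.Periodic.intervalIntegral_le_two_mul {g : ℝ → ℝ} {T x₀ C : ℝ}
    (hg : Function.Periodic g T) (hT : 0 < T)
    (hint : ∀ s t, IntervalIntegrable g volume s t)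
    (h0 : ∫ x in x₀..x₀ + T, g x ≤ 0)
    (hC : ∀ s t, x₀ ≤ s → s ≤ t → t ≤ x₀ + T → ∫ x in s..t, g x ≤ C)
    {s t : ℝ} (hst : s ≤ t) : ∫ x in s..t, g x ≤ 2 * C := by
  have hC0 : 0 ≤ C := by simpa using hC x₀ x₀ le_rfl le_rfl (by linarith)
  obtain ⟨i, hi, -⟩ := existsUnique_sub_zsmul_mem_Ico hT s x₀
  obtain ⟨j, hj, -⟩ := existsUnique_sub_zsmul_mem_Ico hT t x₀
  simp only [zsmul_eq_mul, mem_Ico] at hi hj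
  rcases lt_or_ge j (i + 1) with hji | hji
  · have hij : i = j := by
      refine le_antisymm ?_ (Int.lt_add_one_iff.mp hji)
      by_contra! hlt
      have : (j : ℝ) + 1 ≤ i := by exact_mod_cast hlt
      nlinarith
    subst hij
    rw [← hg.intervalIntegral_sub_int_mul i s t]
    linarith [hC _ _ hi.1 (by linarith) hj.2.le]
  · have hi1 := hC (s - i * T) (x₀ + T) hi.1 hi.2.le le_rfl
    have hj1 := hC x₀ (t - j * T) le_rfl hj.1 hj.2.le
    have e1 : ∫ x in s..x₀ + (i + 1) * T, g x = ∫ x in (s - i * T)..(x₀ + T), g x := by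
      rw [← hg.intervalIntegral_sub_int_mul i]
      congr 1; ring
    have e2 : ∫ x in x₀ + j * T..t, g x = ∫ x in x₀..(t - j * T), g x := by
      rw [← hg.intervalIntegral_sub_int_mul j]
      congr 1; ring
    have e3 : ∫ x in x₀ + (i + 1) * T..x₀ + j * T, g x = (j - (i + 1)) * ∫ x in x₀..x₀ + T, g x := by
      have := hg.intervalIntegral_add_zsmul_eq (j - (i + 1)) (x₀ + (i + 1) * T) hint
      rw [hg.intervalIntegral_add_eq _ x₀] at this
      simp only [zsmul_eq_mul] at this
      push_cast at this
      rw [← this]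
      congr 1; ring
    have hk : (0 : ℝ) ≤ j - (i + 1) := by
      have : (i : ℝ) + 1 ≤ j := by exact_mod_cast hji
      linarith
    rw [← intervalIntegral.integral_add_adjacent_intervals (hint s (x₀ + (i + 1) * T)) (hint _ t),
      ← intervalIntegral.integral_add_adjacent_intervals
        (hint (x₀ + (i + 1) * T) (x₀ + j * T)) (hint _ t), e1, e2, e3]
    nlinarith

theorem Function.Periodic.exists_intervalIntegral_le {g : ℝ → ℝ} {T x₀ : ℝ}
    (hg : Function.Periodic g T) (hT : 0 < T)
    (hint : ∀ s t, IntervalIntegrable g volume s t)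
    (h0 : ∫ x in x₀..x₀ + T, g x ≤ 0) :
    ∃ C, ∀ s t, s ≤ t → ∫ x in s..t, g x ≤ C := by
  refine ⟨2 * ∫ x in x₀..x₀ + T, |g x|, fun s t hst =>
    hg.intervalIntegral_le_two_mul hT hint h0 (fun s t hs hst ht => ?_) hst⟩
  calc ∫ x in s..t, g x ≤ ∫ x in s..t, |g x| :=
        intervalIntegral.integral_mono_on hst (hint _ _) (hint _ _).abs fun x _ => le_abs_self _
    _ ≤ ∫ x in x₀..x₀ + T, |g x| :=
        intervalIntegral.integral_mono_interval hs hst ht (ae_of_all _ fun x => abs_nonneg _)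
          (hint _ _).abs

/-- The `T`-periodic function equal to `g` on `[-M, M)` and to `d` on `[M, T - M)`. -/
def insertStrip (T M : ℝ) (g : ℝ → ℝ) (d x : ℝ) : ℝ :=
  if x + M - T * ⌊(x + M) / T⌋ < 2 * M then g (x - T * ⌊(x + M) / T⌋) else d

section insertStrip

variable {T M d : ℝ} {g : ℝ → ℝ}

theorem insertStrip_comp (G : ℝ → ℝ) (x : ℝ) :
    G (insertStrip T M g d x) = insertStrip T M (fun y => G (g y)) (G d) x := by
  unfold insertStrip; split_ifs <;> rfl

theorem insertStrip_periodic (hT : 0 < T) : Function.Periodic (insertStrip T M g d) T := by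
  intro x
  have h : (x + T + M) / T = (x + M) / T + 1 := by field_simp; ring
  have h2 : ⌊(x + T + M) / T⌋ = ⌊(x + M) / T⌋ + 1 := by rw [h]; exact Int.floor_add_one _
  unfold insertStrip
  rw [h2]
  push_cast
  congr 2 <;> ring_nf

theorem insertStrip_of_mem_core (hM : 2 * M ≤ T) {x : ℝ} (hx : x ∈ Ico (-M) M) :
    insertStrip T M g d x = g x := by
  have hM0 : -M < M := hx.1.trans_lt hx.2
  have hT : 0 < T := by linarith
  have : ⌊(x + M) / T⌋ = 0 := by
    rw [Int.floor_eq_zero_iff]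
    exact ⟨div_nonneg (by linarith [hx.1]) hT.le, by rw [div_lt_one hT]; linarith [hx.2]⟩
  simp only [insertStrip, this]
  rw [if_pos] <;> norm_num; linarith [hx.2]

theorem insertStrip_of_mem_strip (hM : 0 ≤ M) {x : ℝ} (hx : x ∈ Ico M (T - M)) :
    insertStrip T M g d x = d := by
  have hT : 0 < T := by linarith [hx.1.trans_lt hx.2]
  have : ⌊(x + M) / T⌋ = 0 := by
    rw [Int.floor_eq_zero_iff]
    exact ⟨div_nonneg (by linarith [hx.1]) hT.le, by rw [div_lt_one hT]; linarith [hx.2]⟩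
  simp only [insertStrip, this]
  rw [if_neg]; norm_num; linarith [hx.1]

theorem insertStrip_eq_or (x : ℝ) :
    (∃ y, insertStrip T M g d x = g y) ∨ insertStrip T M g d x = d := by
  unfold insertStrip; split_ifs
  · exact Or.inl ⟨_, rfl⟩
  · exact Or.inr rfl

theorem measurable_insertStrip (hg : Measurable g) : Measurable (insertStrip T M g d) := by
  have hfl : Measurable fun x : ℝ => T * (⌊(x + M) / T⌋ : ℝ) := by
    have : Measurable fun x : ℝ => (⌊(x + M) / T⌋ : ℤ) := Int.measurable_floor.comp (by fun_prop)
    exact ((measurable_from_top (f := fun n : ℤ => (n : ℝ))).comp this).const_mul T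
  refine Measurable.ite ?_ (hg.comp (measurable_id.sub hfl)) measurable_const
  exact measurableSet_lt ((measurable_id.add_const M).sub hfl) measurable_const

theorem intervalIntegral_insertStrip_core (hM : 2 * M ≤ T) {s t : ℝ} (hs : -M ≤ s) (hst : s ≤ t)
    (ht : t ≤ M) : ∫ x in s..t, insertStrip T M g d x = ∫ x in s..t, g x := by
  refine intervalIntegral.integral_congr_ae ?_
  filter_upwards [Measure.ae_ne volume M] with x hxM hx
  rw [uIoc_of_le hst] at hx
  exact insertStrip_of_mem_core hM ⟨by linarith [hx.1], lt_of_le_of_ne (hx.2.trans ht) hxM⟩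

theorem intervalIntegral_insertStrip_strip (hM : 0 ≤ M) {s t : ℝ} (hs : M ≤ s) (hst : s ≤ t)
    (ht : t ≤ T - M) : ∫ x in s..t, insertStrip T M g d x = (t - s) * d := by
  rw [← smul_eq_mul, ← intervalIntegral.integral_const]
  refine intervalIntegral.integral_congr_ae ?_
  filter_upwards [Measure.ae_ne volume (T - M)] with x hxM hx
  rw [uIoc_of_le hst] at hx
  exact insertStrip_of_mem_strip hM ⟨by linarith [hx.1], lt_of_le_of_ne (hx.2.trans ht) hxM⟩

theorem intervalIntegral_insertStrip_core_strip (hM : 0 ≤ M) (hMT : 2 * M ≤ T)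
    (hint : ∀ s t, IntervalIntegrable (insertStrip T M g d) volume s t) {s t : ℝ}
    (hs : -M ≤ s) (hsM : s ≤ M) (hMt : M ≤ t) (ht : t ≤ T - M) :
    ∫ x in s..t, insertStrip T M g d x = (∫ x in s..M, g x) + (t - M) * d := by
  rw [← intervalIntegral.integral_add_adjacent_intervals (hint s M) (hint M t),
    intervalIntegral_insertStrip_core hMT hs hsM le_rfl,
    intervalIntegral_insertStrip_strip hM le_rfl hMt ht]

theorem intervalIntegral_insertStrip_strip_core (hM : 0 ≤ M) (hMT : 2 * M ≤ T) (hT : 0 < T)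
    (hint : ∀ s t, IntervalIntegrable (insertStrip T M g d) volume s t) {s t : ℝ}
    (hs : M ≤ s) (hsT : s ≤ T - M) (ht : T - M ≤ t) (htT : t ≤ T + M) :
    ∫ x in s..t, insertStrip T M g d x =
      (∫ x in (-M)..(t - T), g x) + (T - M - s) * d := by
  have h1 := (insertStrip_periodic (M := M) (g := g) (d := d) hT).intervalIntegral_sub_int_mul
    1 (T - M) t
  rw [← intervalIntegral.integral_add_adjacent_intervals (hint s (T - M)) (hint _ t),
    intervalIntegral_insertStrip_strip hM hs hsT le_rfl, ← h1,
    ← intervalIntegral_insertStrip_core (T := T) (M := M) (g := g) (d := d) hMT le_rfl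
      (by linarith) (by linarith), add_comm]
  congr 2 <;> push_cast <;> ring_nf

end insertStrip

/-! ### The admissible region and its tangent half-planes -/

/-- The homogeneous form of the `A_p` condition for an interval of length `T` on which the weight
has integral `U` and its power `-r` has integral `V`, where `r = 1 / (p - 1)`. -/
def Admissible (r Q U V T : ℝ) : Prop := U * V ^ (1 / r) ≤ Q * T ^ (1 + 1 / r)

theorem mul_rpow_le_of_weighted_sum_le {r A B H : ℝ} (hr : 0 < r) (hA : 0 ≤ A) (hB : 0 ≤ B)
    (h : r * A + B ≤ (r + 1) * H) : A * B ^ (1 / r) ≤ H ^ (1 + 1 / r) := by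
  have hgm := Real.geom_mean_le_arith_mean2_weighted (w₁ := r / (r + 1)) (w₂ := 1 / (r + 1))
    (by positivity) (by positivity) hA hB (by field_simp)
  have hH : r / (r + 1) * A + 1 / (r + 1) * B ≤ H := by
    rw [← sub_nonneg] at h ⊢
    have : H - (r / (r + 1) * A + 1 / (r + 1) * B) = ((r + 1) * H - (r * A + B)) / (r + 1) := by
      field_simp
    rw [this]; positivity
  have h2 := Real.rpow_le_rpow (by positivity) (hgm.trans hH)
    (show (0 : ℝ) ≤ 1 + 1 / r by positivity)
  rw [Real.mul_rpow (by positivity) (by positivity), ← Real.rpow_mul hA, ← Real.rpow_mul hB] at h2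
  have e1 : r / (r + 1) * (1 + 1 / r) = 1 := by field_simp
  have e2 : 1 / (r + 1) * (1 + 1 / r) = 1 / r := by field_simp
  rwa [e1, e2, Real.rpow_one] at h2

theorem admissible_of_linear_le {r Q σ c K U V T : ℝ} (hr : 0 < r) (hc : 0 < c) (hσ0 : 0 ≤ σ)
    (hσ1 : σ < 1) (hK : 0 ≤ K) (hKQ : K ^ (1 + 1 / r) ≤ Q * ((1 - σ) * (1 + r * σ) ^ (1 / r)))
    (hU : 0 ≤ U) (hV : 0 ≤ V) (hT : 0 ≤ T)
    (h : r * (1 - σ) / c * U + (1 + r * σ) * c ^ r * V ≤ (r + 1) * (K * T)) :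
    Admissible r Q U V T := by
  have h1σ : 0 < 1 - σ := by linarith
  have he : r * ((1 - σ) / c * U) = r * (1 - σ) / c * U := by ring
  have h1 := mul_rpow_le_of_weighted_sum_le (A := (1 - σ) / c * U) (B := (1 + r * σ) * c ^ r * V)
    (H := K * T) hr (by positivity) (by positivity) (by linarith)
  rw [Real.mul_rpow hK hT, Real.mul_rpow (by positivity) hV, Real.mul_rpow (by positivity)
    (by positivity), ← Real.rpow_mul hc.le, mul_one_div_cancel hr.ne', Real.rpow_one] at h1
  have e : (1 - σ) / c * U * ((1 + r * σ) ^ (1 / r) * c * V ^ (1 / r)) =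
      ((1 - σ) * (1 + r * σ) ^ (1 / r)) * (U * V ^ (1 / r)) := by
    field_simp
  rw [e] at h1
  have hT' : 0 ≤ T ^ (1 + 1 / r) := Real.rpow_nonneg hT _
  have hpos : 0 < (1 - σ) * (1 + r * σ) ^ (1 / r) := by positivity
  unfold Admissible
  nlinarith [mul_le_mul_of_nonneg_right hKQ hT']

/-! ### Blocks -/

/-- A periodic weight with `A_p` constant at most `Q` which keeps this property when it is replaced
by the constant `c` on one side of `L / 2`; `a`, `b`, `m` are its normalized mean values. -/
structure Block (r q Q : ℝ) (f : ℝ → ℝ) (L c a b m : ℝ) : Prop where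
  L_pos : 0 < L
  c_pos : 0 < c
  periodic : Function.Periodic f L
  measurable : Measurable f
  bounds : ∃ lo hi, 0 < lo ∧ ∀ x, f x ∈ Icc lo hi
  admissible : ∀ s t, s ≤ t →
    Admissible r Q (∫ x in s..t, f x) (∫ x in s..t, f x ^ (-r)) (t - s)
  glue_right : ∀ x y, 0 ≤ x → 0 ≤ y → Admissible r Q (x * c + ∫ z in (L / 2)..(L / 2 + y), f z)
    (x * c ^ (-r) + ∫ z in (L / 2)..(L / 2 + y), f z ^ (-r)) (x + y)
  glue_left : ∀ x y, 0 ≤ x → 0 ≤ y → Admissible r Q (x * c + ∫ z in (L / 2 - y)..(L / 2), f z)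
    (x * c ^ (-r) + ∫ z in (L / 2 - y)..(L / 2), f z ^ (-r)) (x + y)
  mean : ∫ x in (0 : ℝ)..L, f x = a * c * L
  mean_neg : ∫ x in (0 : ℝ)..L, f x ^ (-r) = b * c ^ (-r) * L
  mean_pow : ∫ x in (0 : ℝ)..L, f x ^ q = m * c ^ q * L

theorem intervalIntegrable_rpow_of_bounds {f : ℝ → ℝ} (hf : Measurable f)
    (hb : ∃ lo hi, 0 < lo ∧ ∀ x, f x ∈ Icc lo hi) (e s t : ℝ) :
    IntervalIntegrable (fun x => f x ^ e) volume s t := by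
  obtain ⟨lo, hi, hlo, hb⟩ := hb
  have hcont : ContinuousOn (fun v : ℝ => v ^ e) (Icc lo hi) := fun v hv =>
    (Real.continuousAt_rpow_const v e (Or.inl (by linarith [hv.1]))).continuousWithinAt
  obtain ⟨B, hB⟩ := isCompact_Icc.exists_bound_of_continuousOn hcont
  rw [intervalIntegrable_iff]
  refine Measure.integrableOn_of_bounded (M := B) ?_ ?_ ?_
  · simp [uIoc]
  · exact (hf.pow_const e).aestronglyMeasurable
  · exact ae_of_all _ fun x => hB _ (hb x)

theorem intervalIntegrable_of_bounds {f : ℝ → ℝ} (hf : Measurable f)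
    (hb : ∃ lo hi, 0 < lo ∧ ∀ x, f x ∈ Icc lo hi) (s t : ℝ) :
    IntervalIntegrable f volume s t := by
  simpa using intervalIntegrable_rpow_of_bounds hf hb 1 s t

theorem Function.Periodic.intervalIntegral_core {g : ℝ → ℝ} {L : ℝ} (hg : Function.Periodic g L)
    (hint : ∀ s t, IntervalIntegrable g volume s t) (n : ℕ) :
    ∫ x in (-((n + 1 / 2) * L))..((n + 1 / 2) * L), g x = (2 * n + 1) * ∫ x in (0 : ℝ)..L, g x := by
  have h := hg.intervalIntegral_add_zsmul_eq (2 * n + 1) (-((n + 1 / 2) * L)) hint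
  rw [hg.intervalIntegral_add_eq _ 0, zero_add] at h
  simp only [zsmul_eq_mul] at h
  push_cast at h
  rw [← h]
  congr 1; ring

theorem intervalIntegral_insertStrip_period {L T M d : ℝ} {g : ℝ → ℝ} (n : ℕ) (hL : 0 ≤ L)
    (hM : M = (n + 1 / 2) * L) (hMT : 2 * M ≤ T) (hT : 0 < T) (hg : Function.Periodic g L)
    (hint : ∀ s t, IntervalIntegrable g volume s t)
    (hint' : ∀ s t, IntervalIntegrable (insertStrip T M g d) volume s t) (x₀ : ℝ) :
    ∫ x in x₀..x₀ + T, insertStrip T M g d x =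
      (2 * n + 1) * (∫ x in (0 : ℝ)..L, g x) + (T - 2 * M) * d := by
  have hM0 : 0 ≤ M := by rw [hM]; positivity
  rw [(insertStrip_periodic hT).intervalIntegral_add_eq x₀ (-M),
    intervalIntegral_insertStrip_core_strip hM0 hMT hint' le_rfl (by linarith) (by linarith)
      (by linarith), ← hg.intervalIntegral_core hint n, ← hM]
  ring

theorem Block.admissible_insertStrip_of_short {r q Q : ℝ} {f : ℝ → ℝ} {L c a b m T M : ℝ}
    (B : Block r q Q f L c a b m) (n : ℕ) (hM : M = (n + 1 / 2) * L) (hMT : 2 * M ≤ T)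
    (hTM : T ≤ 4 * M) {s t : ℝ} (hst : s ≤ t) (hshort : t - s ≤ T - 2 * M)
    (hint : ∀ e s t : ℝ, IntervalIntegrable (fun x => insertStrip T M f c x ^ e) volume s t) :
    Admissible r Q (∫ x in s..t, insertStrip T M f c x)
      (∫ x in s..t, insertStrip T M f c x ^ (-r)) (t - s) := by
  have hL := B.L_pos
  have hM0 : 0 < M := by rw [hM]; positivity
  have hT : 0 < T := by linarith
  have hneg : (fun x => insertStrip T M f c x ^ (-r)) =
      insertStrip T M (fun y => f y ^ (-r)) (c ^ (-r)) :=
    funext fun x => insertStrip_comp (fun v => v ^ (-r)) x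
  have hint1 : ∀ s t, IntervalIntegrable (insertStrip T M f c) volume s t := fun s t => by
    simpa using hint 1 s t
  have hint2 := hint (-r)
  rw [hneg] at hint2 ⊢
  have hfp := B.periodic
  have hfp2 : Function.Periodic (fun y => f y ^ (-r)) L := B.periodic.comp (fun v => v ^ (-r))
  obtain ⟨k, hk, -⟩ := existsUnique_sub_zsmul_mem_Ico hT s (-M)
  simp only [zsmul_eq_mul, mem_Ico] at hk
  rw [← (insertStrip_periodic (g := f) hT).intervalIntegral_sub_int_mul k,
    ← (insertStrip_periodic (g := fun y => f y ^ (-r)) hT).intervalIntegral_sub_int_mul k,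
    show t - s = (t - k * T) - (s - k * T) by ring]
  have hst' : s - k * T ≤ t - k * T := by linarith
  have hshort' : (t - k * T) - (s - k * T) ≤ T - 2 * M := by linarith
  generalize s - k * T = s at *
  generalize t - k * T = t at *
  rcases lt_or_ge s M with hsM | hsM
  · rcases le_or_gt t M with htM | htM
    · rw [intervalIntegral_insertStrip_core hMT hk.1 hst' htM,
        intervalIntegral_insertStrip_core hMT hk.1 hst' htM]
      exact B.admissible s t hst'
    · rw [intervalIntegral_insertStrip_core_strip hM0.le hMT hint1 hk.1 hsM.le htM.le (by linarith),
        intervalIntegral_insertStrip_core_strip hM0.le hMT hint2 hk.1 hsM.le htM.le (by linarith)]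
      have := B.glue_left (t - M) (M - s) (by linarith) (by linarith)
      rw [← hfp.intervalIntegral_sub_int_mul n, ← hfp2.intervalIntegral_sub_int_mul n,
        add_comm (∫ x in _.._, f x), add_comm (∫ x in _.._, f x ^ (-r))]
      have e1 : s - ((n : ℤ) : ℝ) * L = L / 2 - (M - s) := by push_cast; linarith
      have e2 : M - ((n : ℤ) : ℝ) * L = L / 2 := by push_cast; linarith
      rw [e1, e2, show t - s = (t - M) + (M - s) by ring]
      exact this
  · rcases le_or_gt t (T - M) with htM | htM
    · rw [intervalIntegral_insertStrip_strip hM0.le hsM hst' htM,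
        intervalIntegral_insertStrip_strip hM0.le hsM hst' htM]
      simpa using B.glue_left (t - s) 0 (by linarith) le_rfl
    · rw [intervalIntegral_insertStrip_strip_core hM0.le hMT hT hint1 hsM (by linarith) htM.le
          (by linarith),
        intervalIntegral_insertStrip_strip_core hM0.le hMT hT hint2 hsM (by linarith) htM.le
          (by linarith)]
      have := B.glue_right (T - M - s) (t - T + M) (by linarith) (by linarith)
      rw [← hfp.intervalIntegral_sub_int_mul (-(n + 1)),
        ← hfp2.intervalIntegral_sub_int_mul (-(n + 1)),
        add_comm (∫ x in _.._, f x), add_comm (∫ x in _.._, f x ^ (-r))]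
      have e1 : -M - ((-(n + 1) : ℤ) : ℝ) * L = L / 2 := by push_cast; linarith
      have e2 : t - T - ((-(n + 1) : ℤ) : ℝ) * L = L / 2 + (t - T + M) := by push_cast; linarith
      rw [e1, e2, show t - s = (T - M - s) + (t - T + M) by ring]
      exact this

set_option maxHeartbeats 1000000 in
theorem Block.exists_step {r q Q σ l K : ℝ} {f : ℝ → ℝ} {L c a b m : ℝ}
    (B : Block r q Q f L c a b m) (hr : 0 < r) (hσ0 : 0 < σ) (hσ1 : σ < 1) (hl0 : 0 < l)
    (hl1 : l ≤ 1 / 2) (hK : 1 < K)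
    (hKQ : K ^ (1 + 1 / r) ≤ Q * ((1 - σ) * (1 + r * σ) ^ (1 / r)))
    (hab : r * (1 - σ) * a + (1 + r * σ) * b ≤ r + 1)
    (htri : r * (1 - σ) * (1 - σ * l) + (1 + r * σ) * (1 - σ * l) ^ (-r) ≤ (r + 1) * K) :
    ∃ f' L', Block r q Q f' L' ((1 - σ * l) * c) ((l + (1 - l) * a) / (1 - σ * l))
      ((l + (1 - l) * b) * (1 - σ * l) ^ r) ((l + (1 - l) * m) * (1 - σ * l) ^ (-q)) ∧
      2 * L ≤ L' ∧ ∀ x ∈ Ico (-(L / 2)) (L / 2), f' x = f x := by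
  have hL := B.L_pos
  have hc := B.c_pos
  have hθ : 0 < 1 - σ * l := by nlinarith
  have hr1 : 1 + r * σ > 0 := by positivity
  have h1σ : 0 < 1 - σ := by linarith
  set A₁ := r * (1 - σ) / c with hA₁
  set B₁ := (1 + r * σ) * c ^ r with hB₁
  have hcc : c ^ r * c ^ (-r) = 1 := by rw [← Real.rpow_add hc]; simp
  set ψ : ℝ → ℝ := fun x => A₁ * f x + B₁ * f x ^ (-r) - (r + 1) with hψ
  have hfi := intervalIntegrable_of_bounds B.measurable B.bounds
  have hfe := intervalIntegrable_rpow_of_bounds B.measurable B.bounds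
  have hψi : ∀ s t, IntervalIntegrable ψ volume s t := fun s t =>
    (((hfi s t).const_mul _).add ((hfe (-r) s t).const_mul _)).sub intervalIntegrable_const
  have hψp : Function.Periodic ψ L := B.periodic.comp fun v => A₁ * v + B₁ * v ^ (-r) - (r + 1)
  have hψ0 : ∫ x in (0 : ℝ)..0 + L, ψ x ≤ 0 := by
    rw [zero_add, hψ, intervalIntegral.integral_sub
      (((hfi _ _).const_mul _).add ((hfe (-r) _ _).const_mul _)) intervalIntegrable_const,
      intervalIntegral.integral_add ((hfi _ _).const_mul _) ((hfe (-r) _ _).const_mul _),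
      intervalIntegral.integral_const_mul, intervalIntegral.integral_const_mul, B.mean, B.mean_neg,
      intervalIntegral.integral_const, smul_eq_mul]
    have e : A₁ * (a * c * L) + B₁ * (b * c ^ (-r) * L) - (L - 0) * (r + 1) =
        (r * (1 - σ) * a + (1 + r * σ) * b * (c ^ r * c ^ (-r)) - (r + 1)) * L := by
      rw [hA₁, hB₁]; field_simp; ring
    rw [e, hcc]
    exact mul_nonpos_of_nonpos_of_nonneg (by linarith) hL.le
  obtain ⟨C, hC⟩ := hψp.exists_intervalIntegral_le hL hψi hψ0
  have hC0 : 0 ≤ C := by simpa using hC 0 0 le_rfl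
  have hγ : 0 < (r + 1) * (K - 1) * l * L := by
    have : 0 < K - 1 := by linarith
    positivity
  obtain ⟨n, hn⟩ := exists_nat_ge (2 * C / ((r + 1) * (K - 1) * l * L) + 1)
  obtain ⟨M, hM⟩ : ∃ M, M = (n + 1 / 2) * L := ⟨_, rfl⟩
  have hn0 : 0 ≤ 2 * C / ((r + 1) * (K - 1) * l * L) := div_nonneg (by linarith) hγ.le
  have hn1 : (1 : ℝ) ≤ n := by linarith
  have hnC : 2 * C ≤ (r + 1) * (K - 1) * l * M := by
    have h : 2 * C / ((r + 1) * (K - 1) * l * L) ≤ n := by linarith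
    rw [div_le_iff₀ hγ] at h
    rw [hM]
    nlinarith
  have hLM : L ≤ M := by rw [hM]; nlinarith
  have hM0 : 0 < M := hL.trans_le hLM
  obtain ⟨T, hTdef⟩ : ∃ T, T = 2 * M / (1 - l) := ⟨_, rfl⟩
  have hl' : 0 < 1 - l := by linarith
  have hTl : T * (1 - l) = 2 * M := by rw [hTdef]; field_simp
  have hMT : 2 * M ≤ T := by
    rw [hTdef, le_div_iff₀ hl']; nlinarith
  have hTM : T ≤ 4 * M := by rw [hTdef, div_le_iff₀ hl']; nlinarith
  have hT : 0 < T := by linarith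
  have hS : 2 * C ≤ (r + 1) * (K - 1) * (T / 2 - M) := by
    have : l * M ≤ T / 2 - M := by nlinarith
    have h2 : 0 ≤ (r + 1) * (K - 1) := mul_nonneg (by linarith) (by linarith)
    have h3 := mul_le_mul_of_nonneg_left this h2
    rw [← mul_assoc] at h3
    exact hnC.trans h3
  set f' := insertStrip T M f c with hf'
  have hf'm : Measurable f' := measurable_insertStrip B.measurable
  have hf'b : ∃ lo hi, 0 < lo ∧ ∀ x, f' x ∈ Icc lo hi := by
    obtain ⟨lo, hi, hlo, h⟩ := B.bounds
    refine ⟨min lo c, max hi c, lt_min hlo hc, fun x => ?_⟩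
    rcases insertStrip_eq_or (T := T) (M := M) (g := f) (d := c) x with ⟨y, hy⟩ | hy
    · rw [hf', hy]; exact ⟨min_le_of_left_le (h y).1, le_max_of_le_left (h y).2⟩
    · rw [hf', hy]; exact ⟨min_le_right _ _, le_max_right _ _⟩
  have hf'pos : ∀ x, 0 ≤ f' x := fun x => by
    obtain ⟨lo, hi, hlo, h⟩ := hf'b
    exact hlo.le.trans (h x).1
  have hf'i := intervalIntegrable_of_bounds hf'm hf'b
  have hf'e := intervalIntegrable_rpow_of_bounds hf'm hf'b
  have hcomp : ∀ e : ℝ, (fun x => f' x ^ e) = insertStrip T M (fun y => f y ^ e) (c ^ e) :=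
    fun e => funext fun x => insertStrip_comp (fun v => v ^ e) x
  have hψ' : (fun x => A₁ * f' x + B₁ * f' x ^ (-r) - (r + 1)) = insertStrip T M ψ 0 := by
    funext x
    rw [insertStrip_comp (fun v => A₁ * v + B₁ * v ^ (-r) - (r + 1)) x]
    congr 1
    rw [show A₁ * c + B₁ * c ^ (-r) - (r + 1) = A₁ * c + (1 + r * σ) * (c ^ r * c ^ (-r)) - (r + 1)
      by rw [hB₁]; ring, hcc, hA₁]
    field_simp
    ring
  have hψ'i : ∀ s t, IntervalIntegrable (insertStrip T M ψ 0) volume s t := fun s t => by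
    rw [← hψ']
    exact (((hf'i s t).const_mul _).add ((hf'e (-r) s t).const_mul _)).sub intervalIntegrable_const
  have hψ'e : ∀ s t, ∫ x in s..t, insertStrip T M ψ 0 x =
      A₁ * (∫ x in s..t, f' x) + B₁ * (∫ x in s..t, f' x ^ (-r)) - (r + 1) * (t - s) := by
    intro s t
    rw [← hψ', intervalIntegral.integral_sub
      (((hf'i _ _).const_mul _).add ((hf'e (-r) _ _).const_mul _)) intervalIntegrable_const,
      intervalIntegral.integral_add ((hf'i _ _).const_mul _) ((hf'e (-r) _ _).const_mul _),
      intervalIntegral.integral_const_mul, intervalIntegral.integral_const_mul,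
      intervalIntegral.integral_const, smul_eq_mul]
    ring
  have hψ'C : ∀ s t, s ≤ t → ∫ x in s..t, insertStrip T M ψ 0 x ≤ 2 * C := by
    intro s t hst
    refine (insertStrip_periodic hT).intervalIntegral_le_two_mul (x₀ := -M) hT hψ'i ?_ ?_ hst
    · rw [intervalIntegral_insertStrip_period n hL.le hM hMT hT hψp hψi hψ'i]
      rw [zero_add] at hψ0
      nlinarith
    · intro s t hs hst ht
      rcases le_or_gt t M with htM | htM
      · rw [intervalIntegral_insertStrip_core hMT hs hst htM]
        exact hC _ _ hst
      · rcases le_or_gt M s with hsM | hsM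
        · rw [intervalIntegral_insertStrip_strip hM0.le hsM hst (by linarith)]
          simpa using hC0
        · rw [intervalIntegral_insertStrip_core_strip hM0.le hMT hψ'i hs hsM.le htM.le (by linarith)]
          simpa using hC _ _ hsM.le
  have hUnn : ∀ s t, s ≤ t → 0 ≤ ∫ x in s..t, f' x := fun s t hst =>
    intervalIntegral.integral_nonneg hst fun x _ => hf'pos x
  have hVnn : ∀ s t, s ≤ t → 0 ≤ ∫ x in s..t, f' x ^ (-r) := fun s t hst =>
    intervalIntegral.integral_nonneg hst fun x _ => Real.rpow_nonneg (hf'pos x) _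
  have hglue : ∀ s t x, s ≤ t → 0 ≤ x →
      (∫ z in s..t, insertStrip T M ψ 0 z ≤ (r + 1) * (K - 1) * (t - s)) →
      Admissible r Q (x * ((1 - σ * l) * c) + ∫ z in s..t, f' z)
        (x * ((1 - σ * l) * c) ^ (-r) + ∫ z in s..t, f' z ^ (-r)) (x + (t - s)) := by
    intro s t x hst hx h
    refine admissible_of_linear_le hr hc hσ0.le hσ1 (by linarith) hKQ
      (add_nonneg (by positivity) (hUnn s t hst)) (add_nonneg (by positivity) (hVnn s t hst))
      (by linarith) ?_
    rw [hψ'e] at h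
    have e : A₁ * (x * ((1 - σ * l) * c)) + B₁ * (x * ((1 - σ * l) * c) ^ (-r)) =
        x * (r * (1 - σ) * (1 - σ * l) + (1 + r * σ) * (1 - σ * l) ^ (-r) * (c ^ r * c ^ (-r))) := by
      rw [Real.mul_rpow hθ.le hc.le, hA₁, hB₁]
      field_simp
    rw [hcc, mul_one] at e
    have := mul_le_mul_of_nonneg_left htri hx
    rw [← e] at this
    linarith
  have hstripint : ∀ s t, M ≤ s → s ≤ t → t ≤ T - M → ∫ x in s..t, insertStrip T M ψ 0 x = 0 := by
    intro s t hs hst ht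
    rw [intervalIntegral_insertStrip_strip hM0.le hs hst ht, mul_zero]
  have hKK : 0 ≤ (r + 1) * (K - 1) := mul_nonneg (by linarith) (by linarith)
  have hlarge : ∀ s t, s ≤ t → T / 2 - M ≤ t - s →
      ∫ x in s..t, insertStrip T M ψ 0 x ≤ (r + 1) * (K - 1) * (t - s) := fun s t hst h =>
    (hψ'C s t hst).trans (hS.trans (mul_le_mul_of_nonneg_left h hKK))
  have hper : ∀ e : ℝ, ∫ x in (0 : ℝ)..T, f' x ^ e =
      (1 - l) * T / L * (∫ x in (0 : ℝ)..L, f x ^ e) + l * T * c ^ e := by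
    intro e
    have h := intervalIntegral_insertStrip_period n hL.le hM hMT hT
      (B.periodic.comp fun v => v ^ e) (hfe e) (fun s t => by
        have := hf'e e s t
        rwa [hcomp e] at this) 0 (d := c ^ e)
    rw [zero_add] at h
    rw [hcomp e]
    refine h.trans ?_
    have e1 : (1 - l) * T / L = 2 * n + 1 := by
      rw [mul_comm, hTl, hM]; field_simp
    rw [e1]
    congr 2
    linarith
  have hper1 := hper 1
  simp only [Real.rpow_one] at hper1
  refine ⟨f', T, ⟨hT, by positivity, insertStrip_periodic hT, hf'm, hf'b, ?_, ?_, ?_, ?_, ?_, ?_⟩,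
    by nlinarith, fun x hx => insertStrip_of_mem_core hMT
      ⟨by linarith [hx.1], by linarith [hx.2]⟩⟩
  · intro s t hst
    rcases le_or_gt (t - s) (T - 2 * M) with hshort | hlong
    · exact B.admissible_insertStrip_of_short n hM hMT hTM hst hshort hf'e
    · have := hglue s t 0 hst le_rfl (hlarge s t hst (by linarith))
      simpa using this
  · intro x y hx hy
    have := hglue (T / 2) (T / 2 + y) x (by linarith) hx (by
      rcases le_or_gt y (T / 2 - M) with h | h
      · rw [hstripint _ _ (by linarith) (by linarith) (by linarith)]
        exact mul_nonneg hKK (by linarith)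
      · exact hlarge _ _ (by linarith) (by linarith))
    simpa using this
  · intro x y hx hy
    have := hglue (T / 2 - y) (T / 2) x (by linarith) hx (by
      rcases le_or_gt y (T / 2 - M) with h | h
      · rw [hstripint _ _ (by linarith) (by linarith) (by linarith)]
        exact mul_nonneg hKK (by linarith)
      · exact hlarge _ _ (by linarith) (by linarith))
    simpa using this
  · rw [hper1, B.mean]
    generalize 1 - σ * l = θ at hθ
    field_simp
    ring
  · have := (Real.rpow_pos_of_pos hθ r).ne'
    rw [hper, B.mean_neg, Real.mul_rpow hθ.le hc.le, Real.rpow_neg hθ.le]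
    generalize (1 - σ * l) ^ r = θ at this
    field_simp
    ring
  · have := (Real.rpow_pos_of_pos hθ q).ne'
    rw [hper, B.mean_pow, Real.mul_rpow hθ.le hc.le, Real.rpow_neg hθ.le]
    generalize (1 - σ * l) ^ q = θ at this
    field_simp
    ring

/-! ### Choice of parameters -/

theorem one_add_mul_le_one_sub_rpow_neg {e τ : ℝ} (he : 0 ≤ e) (hτ : τ < 1) :
    1 + e * τ ≤ (1 - τ) ^ (-e) := by
  have h : 0 < 1 - τ := by linarith
  rw [Real.rpow_def_of_pos h]
  have h1 := Real.log_le_sub_one_of_pos h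
  have h2 := Real.add_one_le_exp (Real.log (1 - τ) * -e)
  nlinarith

theorem exists_one_lt_rpow_le {r Q s σ : ℝ} (hr : 0 < r) (hQ : 0 < Q) (hs1 : s < 1)
    (hs : (1 - s) * (1 + r * s) ^ (1 / r) = 1 / Q) (hσ0 : 0 < σ) (hσs : σ < s) :
    ∃ K, 1 < K ∧ K ^ (1 + 1 / r) ≤ Q * ((1 - σ) * (1 + r * σ) ^ (1 / r)) := by
  have h1σ : 0 < 1 - σ := by linarith
  have h1s : 0 < 1 - s := by linarith
  have hrσ : 0 < 1 + r * σ := by positivity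
  have hrs : 0 < 1 + r * s := by nlinarith
  set H := (r * ((1 - s) / (1 - σ)) + (1 + r * s) / (1 + r * σ)) / (r + 1) with hH
  have hH0 : 0 < H := by positivity
  have hH1 : H < 1 := by
    have e : 1 - H = r * (s - σ) * (σ * (r + 1)) / ((1 - σ) * (1 + r * σ) * (r + 1)) := by
      rw [hH]; field_simp; ring
    have : 0 < 1 - H := by
      rw [e]
      have : 0 < s - σ := by linarith
      positivity
    linarith
  have h := mul_rpow_le_of_weighted_sum_le (A := (1 - s) / (1 - σ)) (B := (1 + r * s) / (1 + r * σ))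
    (H := H) hr (by positivity) (by positivity) (by rw [hH]; field_simp; exact le_rfl)
  rw [Real.div_rpow hrs.le hrσ.le, div_mul_div_comm, hs] at h
  refine ⟨H⁻¹, (one_lt_inv₀ hH0).2 hH1, ?_⟩
  have hX : 0 < (1 - σ) * (1 + r * σ) ^ (1 / r) := by positivity
  rw [Real.inv_rpow hH0.le]
  refine inv_le_of_inv_le₀ (by positivity) (le_trans (le_of_eq ?_) h)
  field_simp

theorem exists_step_size {r s σ K κ : ℝ} (hr : 0 < r) (hσs : σ < s) (hK : 1 < K) (hκ : 0 < κ) :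
    ∃ l, 0 < l ∧ l ≤ 1 / 2 ∧ l ≤ κ ∧ (1 - σ * l) ^ (-r) ≤ 1 + r * s * l ∧
      r * (1 - σ) * (1 - σ * l) + (1 + r * σ) * (1 - σ * l) ^ (-r) ≤ (r + 1) * K := by
  have hd : HasDerivAt (fun l : ℝ => 1 + r * s * l - (1 - σ * l) ^ (-r)) (r * (s - σ)) 0 := by
    have h1 : HasDerivAt (fun l : ℝ => 1 - σ * l) (-σ) 0 := by
      simpa using ((hasDerivAt_id (0 : ℝ)).const_mul σ).const_sub 1
    have h2 := h1.rpow_const (p := -r) (Or.inl (by simp))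
    have h3 : HasDerivAt (fun l : ℝ => 1 + r * s * l) (r * s) 0 := by
      simpa using ((hasDerivAt_id (0 : ℝ)).const_mul (r * s)).const_add 1
    refine (h3.sub h2).congr_deriv ?_
    simp
    ring
  have hpos : 0 < r * (s - σ) := mul_pos hr (by linarith)
  have hev1 : ∀ᶠ l in nhdsWithin (0 : ℝ) (Ioi 0), (1 - σ * l) ^ (-r) ≤ 1 + r * s * l := by
    have := (hasDerivAt_iff_tendsto_slope.1 hd).eventually (lt_mem_nhds hpos)
    have h2 := this.filter_mono (nhdsWithin_mono (0 : ℝ) fun x (hx : 0 < x) => hx.ne')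
    filter_upwards [h2, self_mem_nhdsWithin] with l hl hl0
    simp only [slope_def_field, mul_zero, sub_zero, Real.one_rpow, add_zero, sub_self] at hl
    have := (div_pos_iff_of_pos_right (show 0 < l from hl0)).1 hl
    linarith
  have hcont : ContinuousAt
      (fun l : ℝ => r * (1 - σ) * (1 - σ * l) + (1 + r * σ) * (1 - σ * l) ^ (-r)) 0 := by
    have h1 : ContinuousAt (fun l : ℝ => 1 - σ * l) 0 := by fun_prop
    exact (continuousAt_const.mul h1).add
      (continuousAt_const.mul (h1.rpow_const (Or.inl (by simp))))
  have hev2 : ∀ᶠ l in nhdsWithin (0 : ℝ) (Ioi 0),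
      r * (1 - σ) * (1 - σ * l) + (1 + r * σ) * (1 - σ * l) ^ (-r) < (r + 1) * K :=
    (hcont.eventually_lt continuousAt_const (by simp; nlinarith)).filter_mono nhdsWithin_le_nhds
  have hev3 : ∀ᶠ l in nhdsWithin (0 : ℝ) (Ioi 0), l ∈ Ioo 0 (min (1 / 2) κ) :=
    Ioo_mem_nhdsGT (lt_min (by norm_num) hκ)
  obtain ⟨l, h1, h2, h3⟩ := (hev1.and (hev2.and hev3)).exists
  exact ⟨l, h3.1, (h3.2.trans_le (min_le_left _ _)).le, (h3.2.trans_le (min_le_right _ _)).le,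
    h1, h2.le⟩

/-! ### Iterating the construction -/

set_option maxHeartbeats 400000 in
theorem Block.exists_iterate {r q Q s σ l K : ℝ} {f : ℝ → ℝ} {L c a b m : ℝ}
    (B : Block r q Q f L c a b m) (hr : 0 < r) (hq : 0 < q) (hσ0 : 0 < σ) (hσ1 : σ < 1)
    (hs : 0 < s) (hqσ : q * σ < 1) (hl0 : 0 < l) (hl1 : l ≤ 1 / 2) (hlq : l ≤ 1 - q * σ)
    (hls : (1 - σ * l) ^ (-r) ≤ 1 + r * s * l) (hK : 1 < K)
    (hKQ : K ^ (1 + 1 / r) ≤ Q * ((1 - σ) * (1 + r * σ) ^ (1 / r)))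
    (htri : r * (1 - σ) * (1 - σ * l) + (1 + r * σ) * (1 - σ * l) ^ (-r) ≤ (r + 1) * K)
    {D E G : ℝ} (hE0 : 0 ≤ E) (hb : 0 < b) (hm : 0 < m)
    (ha1 : (1 - σ) * a ≤ 1) (hab : r * (1 - σ) * a + (1 + r * σ) * b ≤ r + 1)
    (hD : 1 - (1 - σ) * a ≤ D) (hE : 1 - (1 + r * s) * b ≤ E)
    (hG : 1 / (2 * (1 - q * σ)) - m ≤ G) (k : ℕ) :
    ∃ f' L' c' a' b' m', Block r q Q f' L' c' a' b' m' ∧ 2 ^ k * L ≤ L' ∧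
      (∀ x ∈ Ico (-(L / 2)) (L / 2), f' x = f x) ∧ 0 < b' ∧ 0 < m' ∧ (1 - σ) * a' ≤ 1 ∧
      r * (1 - σ) * a' + (1 + r * σ) * b' ≤ r + 1 ∧
      1 - (1 - σ) * a' ≤ ((1 - l) / (1 - σ * l)) ^ k * D ∧ 1 - (1 + r * s) * b' ≤ (1 - l) ^ k * E ∧
      1 / (2 * (1 - q * σ)) - m' ≤ (1 - 2 * l * (1 - q * σ)) ^ k * G := by
  induction k with
  | zero => exact ⟨f, L, c, a, b, m, B, by simp, fun _ _ => rfl, hb, hm, ha1, hab,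
      by rwa [pow_zero, one_mul], by rwa [pow_zero, one_mul], by rwa [pow_zero, one_mul]⟩
  | succ k ih =>
    obtain ⟨f₁, L₁, c₁, a₁, b₁, m₁, B₁, hL₁, hf₁, hb₁, hm₁, ha₁, hab₁, hD₁, hE₁, hG₁⟩ := ih
    obtain ⟨f₂, L₂, B₂, hL₂, hf₂⟩ := B₁.exists_step hr hσ0 hσ1 hl0 hl1 hK hKQ hab₁ htri
    have hLpos := B.L_pos
    have hLL : L ≤ L₁ := le_trans (le_mul_of_one_le_left hLpos.le (one_le_pow₀ (by norm_num))) hL₁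
    have hσl : σ * l < 1 := by nlinarith
    have hθ : 0 < 1 - σ * l := by linarith
    have hl' : 0 < 1 - l := by linarith
    have hrs : 0 < 1 + r * s * l := by positivity
    have hrσ : 0 < 1 + r * (σ * l) := by positivity
    have hθr := Real.rpow_pos_of_pos hθ r
    have hθr1 : (1 - σ * l) ^ r * (1 + r * (σ * l)) ≤ 1 := by
      have := one_add_mul_le_one_sub_rpow_neg hr.le hσl
      rw [Real.rpow_neg hθ.le] at this
      calc _ ≤ (1 - σ * l) ^ r * ((1 - σ * l) ^ r)⁻¹ := by gcongr
        _ = 1 := mul_inv_cancel₀ hθr.ne'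
    have hθr2 : 1 ≤ (1 - σ * l) ^ r * (1 + r * s * l) := by
      rw [Real.rpow_neg hθ.le] at hls
      calc _ = (1 - σ * l) ^ r * ((1 - σ * l) ^ r)⁻¹ := (mul_inv_cancel₀ hθr.ne').symm
        _ ≤ _ := by gcongr
    have hθq := one_add_mul_le_one_sub_rpow_neg hq.le hσl
    have hδ : 1 - (1 - σ) * ((l + (1 - l) * a₁) / (1 - σ * l)) =
        (1 - l) / (1 - σ * l) * (1 - (1 - σ) * a₁) := by
      field_simp
      ring
    have hx : 0 < (1 - l) / (1 - σ * l) := by positivity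
    have hδ₁ : 0 ≤ 1 - (1 - σ) * a₁ := by linarith
    refine ⟨f₂, L₂, _, _, _, _, B₂, ?_, ?_, by positivity,
      mul_pos (by positivity) (Real.rpow_pos_of_pos hθ _), ?_, ?_, ?_, ?_, ?_⟩
    · rw [pow_succ]; linarith
    · intro x hx
      rw [hf₂ x ⟨by linarith [hx.1], by linarith [hx.2]⟩, hf₁ x hx]
    · have := mul_nonneg hx.le hδ₁
      linarith
    · have h1 : (1 + r * (σ * l)) * ((1 + r * σ) * ((l + (1 - l) * b₁) * (1 - σ * l) ^ r)) ≤
          (1 + r * σ) * (l + (1 - l) * b₁) := by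
        have : 0 ≤ (1 + r * σ) * (l + (1 - l) * b₁) := by positivity
        linarith [mul_le_mul_of_nonneg_left hθr1 this]
      have h2 : (1 + r * σ) * ((l + (1 - l) * b₁) * (1 - σ * l) ^ r) - 1 ≤
          (1 - l) * (r * (1 - (1 - σ) * a₁)) / (1 + r * (σ * l)) := by
        rw [le_div_iff₀ hrσ]
        have : (1 - l) * ((1 + r * σ) * b₁) ≤ (1 - l) * (1 + r * (1 - (1 - σ) * a₁)) := by
          gcongr; linarith
        linarith
      have h3 : (1 - l) * (r * (1 - (1 - σ) * a₁)) / (1 + r * (σ * l)) ≤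
          (1 - l) * (r * (1 - (1 - σ) * a₁)) / (1 - σ * l) := by
        gcongr
        have : 0 ≤ r * (σ * l) := by positivity
        have : 0 ≤ σ * l := by positivity
        linarith
      have h4 : r * (1 - σ) * ((l + (1 - l) * a₁) / (1 - σ * l)) =
          r - (1 - l) * (r * (1 - (1 - σ) * a₁)) / (1 - σ * l) := by
        rw [show r * (1 - σ) * ((l + (1 - l) * a₁) / (1 - σ * l)) =
          r * (1 - (1 - (1 - σ) * ((l + (1 - l) * a₁) / (1 - σ * l)))) by ring, hδ]
        ring
      linarith
    · rw [hδ, pow_succ']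
      linarith [mul_le_mul_of_nonneg_left hD₁ hx.le]
    · have he : 0 ≤ (1 - l) ^ k * E := by positivity
      have hEn : 0 ≤ (1 - l) ^ (k + 1) * E := by positivity
      have h1 : (1 + r * s) * (l + (1 - l) * b₁) ≤
          (1 + r * s * l) * ((1 + r * s) * ((l + (1 - l) * b₁) * (1 - σ * l) ^ r)) := by
        have : 0 ≤ (1 + r * s) * (l + (1 - l) * b₁) := by positivity
        linarith [mul_le_mul_of_nonneg_left hθr2 this]
      have h2 : (1 + r * s * l) * (1 - (1 - l) ^ (k + 1) * E) ≤
          (1 + r * s) * (l + (1 - l) * b₁) := by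
        have h3 : (1 - l) * (1 - (1 - l) ^ k * E) ≤ (1 - l) * ((1 + r * s) * b₁) := by
          gcongr; linarith
        have h4 : 0 ≤ r * s * l * ((1 - l) ^ (k + 1) * E) := by positivity
        rw [pow_succ'] at h4 ⊢
        linarith
      have := le_of_mul_le_mul_left (h2.trans h1) hrs
      linarith
    · have hpos : 0 < l + (1 - l) * m₁ := by positivity
      have hκ : 0 < 1 - q * σ := by linarith
      have h1 : (l + (1 - l) * m₁) * (1 + q * (σ * l)) ≤
          (l + (1 - l) * m₁) * (1 - σ * l) ^ (-q) := by gcongr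
      have hqσ0 : 0 ≤ q * σ := by positivity
      have h2 : l + (1 - 2 * l * (1 - q * σ)) * m₁ ≤ (l + (1 - l) * m₁) * (1 + q * (σ * l)) := by
        have h3 : q * σ * l ≤ 1 - q * σ :=
          (mul_le_of_le_one_left hl0.le hqσ.le).trans hlq
        have h4 := mul_le_mul_of_nonneg_left h3 (show 0 ≤ l * m₁ by positivity)
        have h5 : 0 ≤ q * σ * (l * l) := by positivity
        linarith
      have hz : 0 ≤ 1 - 2 * l * (1 - q * σ) := by
        have : 2 * l * (1 - q * σ) ≤ 1 * 1 :=
          mul_le_mul (by linarith) (by linarith) hκ.le zero_le_one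
        linarith
      have h6 := mul_le_mul_of_nonneg_left hG₁ hz
      have h7 : (1 - 2 * l * (1 - q * σ)) * (1 / (2 * (1 - q * σ))) =
          1 / (2 * (1 - q * σ)) - l := by
        field_simp
      rw [pow_succ']
      linarith

/-- From a block in the interior of the admissible region one can reach blocks, again in the
interior, with `A_p` average almost `Q` and arbitrarily large `q`-th moment. -/
theorem Block.exists_extension {r q Q s : ℝ} {f : ℝ → ℝ} {L c a b m : ℝ}
    (B : Block r q Q f L c a b m) (hr : 0 < r) (hQ : 0 < Q) (hs0 : 0 < s) (hs1 : s < 1)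
    (hqs : q * s = 1) (hs : (1 - s) * (1 + r * s) ^ (1 / r) = 1 / Q) (hb : 0 < b) (hm : 0 < m)
    (ha : (1 - s) * a < 1) (hab : r * (1 - s) * a + (1 + r * s) * b < r + 1)
    {Q' N : ℝ} (hQ' : Q' < Q) (hN : 0 ≤ N) :
    ∃ f' L' c' a' b' m', Block r q Q f' L' c' a' b' m' ∧ 2 * L ≤ L' ∧
      (∀ x ∈ Ico (-(L / 2)) (L / 2), f' x = f x) ∧ 0 < a' ∧ 0 < b' ∧ 0 < m' ∧ (1 - s) * a' < 1 ∧
      r * (1 - s) * a' + (1 + r * s) * b' < r + 1 ∧ Q' < a' * b' ^ (1 / r) ∧ N * a' ^ q ≤ m' := by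
  have h1s : 0 < 1 - s := by linarith
  have hrs : 0 < 1 + r * s := by positivity
  have hq : 0 < q := pos_of_mul_pos_left (by rw [hqs]; exact one_pos) hs0.le
  set X := 1 + N * (1 / (1 - s)) ^ q with hX
  have hX0 : 0 < X := by positivity
  have hQs : 1 / (1 - s) * (1 / (1 + r * s)) ^ (1 / r) = Q := by
    rw [Real.div_rpow zero_le_one hrs.le, Real.one_rpow, div_mul_div_comm, hs]
    simp
  obtain ⟨σ, hσs, hσ0, hσa, hσab, hσQ, hσX⟩ : ∃ σ < s, 0 < σ ∧ (1 - σ) * a < 1 ∧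
      r * (1 - σ) * a + (1 + r * σ) * b < r + 1 ∧
      Q' < 1 / (1 - σ) * (1 / (1 + r * s)) ^ (1 / r) ∧ 2 * (1 - q * σ) * X < 1 := by
    have e1 : ∀ᶠ σ in nhds s, 0 < σ := lt_mem_nhds hs0
    have e2 : ∀ᶠ σ in nhds s, (1 - σ) * a < 1 :=
      (show ContinuousAt (fun σ => (1 - σ) * a) s by fun_prop).eventually_lt continuousAt_const ha
    have e3 : ∀ᶠ σ in nhds s, r * (1 - σ) * a + (1 + r * σ) * b < r + 1 :=
      (show ContinuousAt (fun σ => r * (1 - σ) * a + (1 + r * σ) * b) s by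
        fun_prop).eventually_lt continuousAt_const hab
    have e4 : ∀ᶠ σ in nhds s, Q' < 1 / (1 - σ) * (1 / (1 + r * s)) ^ (1 / r) :=
      continuousAt_const.eventually_lt
        (show ContinuousAt (fun σ => 1 / (1 - σ) * (1 / (1 + r * s)) ^ (1 / r)) s from
          (continuousAt_const.div (by fun_prop) h1s.ne').mul continuousAt_const) (by rwa [hQs])
    have e5 : ∀ᶠ σ in nhds s, 2 * (1 - q * σ) * X < 1 :=
      (show ContinuousAt (fun σ => 2 * (1 - q * σ) * X) s by
        fun_prop).eventually_lt continuousAt_const (by simp [hqs])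
    obtain ⟨σ, hσ, h1, h2, h3, h4, h5⟩ := ((eventually_mem_nhdsWithin (s := Iio s)).and
      ((e1.and (e2.and (e3.and (e4.and e5)))).filter_mono nhdsWithin_le_nhds)).exists
    exact ⟨σ, hσ, h1, h2, h3, h4, h5⟩
  have hσ1 : σ < 1 := by linarith
  have h1σ : 0 < 1 - σ := by linarith
  have hrσ : 0 < 1 + r * σ := by positivity
  have hqσ : q * σ < 1 := hqs ▸ mul_lt_mul_of_pos_left hσs hq
  have hκ : 0 < 1 - q * σ := by linarith
  have hXF : X ≤ 1 / (2 * (1 - q * σ)) := by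
    rw [le_div_iff₀ (by positivity)]
    linarith
  obtain ⟨ε, hε0, hε1, hεab, hεQ⟩ : ∃ ε, 0 < ε ∧ ε < 1 ∧
      r * (1 - s) * ((1 - ε) / (1 - σ)) + (1 + r * s) * ((1 + r * ε) / (1 + r * σ)) < r + 1 ∧
      Q' < (1 - ε) / (1 - σ) * ((1 - ε) / (1 + r * s)) ^ (1 / r) := by
    have e1 : ∀ᶠ ε in nhds (0 : ℝ), ε < 1 := gt_mem_nhds one_pos
    have e2 : ∀ᶠ ε in nhds (0 : ℝ), r * (1 - s) * ((1 - ε) / (1 - σ)) +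
        (1 + r * s) * ((1 + r * ε) / (1 + r * σ)) < r + 1 := by
      refine (show ContinuousAt (fun ε => r * (1 - s) * ((1 - ε) / (1 - σ)) +
        (1 + r * s) * ((1 + r * ε) / (1 + r * σ))) 0 by fun_prop).eventually_lt
        continuousAt_const ?_
      have e : r + 1 - (r * (1 - s) * ((1 - 0) / (1 - σ)) +
          (1 + r * s) * ((1 + r * 0) / (1 + r * σ))) =
          r * (s - σ) * (σ * (r + 1)) / ((1 - σ) * (1 + r * σ)) := by
        field_simp
        ring
      have : 0 < r * (s - σ) * (σ * (r + 1)) / ((1 - σ) * (1 + r * σ)) := by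
        have : 0 < s - σ := by linarith
        positivity
      linarith
    have e3 : ∀ᶠ ε in nhds (0 : ℝ), Q' < (1 - ε) / (1 - σ) * ((1 - ε) / (1 + r * s)) ^ (1 / r) :=
      continuousAt_const.eventually_lt
        (show ContinuousAt (fun ε => (1 - ε) / (1 - σ) * ((1 - ε) / (1 + r * s)) ^ (1 / r)) 0 from
          (show ContinuousAt (fun ε => (1 - ε) / (1 - σ)) 0 by fun_prop).mul
            ((show ContinuousAt (fun ε => (1 - ε) / (1 + r * s)) 0 by fun_prop).rpow_const
              (Or.inr (by positivity)))) (by simpa using hσQ)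
    obtain ⟨ε, hε, h1, h2, h3⟩ := ((eventually_mem_nhdsWithin (s := Ioi (0 : ℝ))).and
      ((e1.and (e2.and e3)).filter_mono nhdsWithin_le_nhds)).exists
    exact ⟨ε, hε, h1, h2, h3⟩
  obtain ⟨K, hK, hKQ⟩ := exists_one_lt_rpow_le hr hQ hs1 hs hσ0 hσs
  obtain ⟨l, hl0, hl1, hlq, hls, htri⟩ := exists_step_size hr hσs hK hκ
  have hσl : σ * l < l := mul_lt_of_lt_one_left hl0 hσ1
  have hpow : ∀ x C : ℝ, 0 ≤ x → x < 1 → ∀ᶠ k : ℕ in atTop, x ^ k * C < ε := fun x C h0 h1 => by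
    have := (tendsto_pow_atTop_nhds_zero_of_lt_one h0 h1).mul_const C
    rw [zero_mul] at this
    exact this.eventually (gt_mem_nhds hε0)
  have hz : 2 * l * (1 - q * σ) ≤ 1 :=
    mul_le_one₀ (by linarith) hκ.le (by linarith [mul_pos hq hσ0])
  obtain ⟨k, hx, hy, hz, hk⟩ := ((hpow ((1 - l) / (1 - σ * l)) (1 - (1 - σ) * a)
    (div_nonneg (by linarith) (by linarith)) ((div_lt_one (by linarith)).2 (by linarith))).and
    ((hpow (1 - l) |1 - (1 + r * s) * b| (by linarith) (by linarith)).and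
    ((hpow (1 - 2 * l * (1 - q * σ)) (1 / (2 * (1 - q * σ)) - m) (by linarith)
      (by linarith [mul_pos hl0 hκ])).and (eventually_ge_atTop 1)))).exists
  obtain ⟨f', L', c', a', b', m', B', hL', hf', hb', hm', ha', hab', hD, hE, hG⟩ :=
    B.exists_iterate hr hq hσ0 hσ1 hs0 hqσ hl0 hl1 hlq hls hK hKQ htri (abs_nonneg _) hb hm
      hσa.le hσab.le le_rfl (le_abs_self _) le_rfl k
  have ha₁ : (1 - ε) / (1 - σ) ≤ a' := by
    rw [div_le_iff₀ h1σ]; linarith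
  have ha₂ : a' ≤ 1 / (1 - σ) := by
    rw [le_div_iff₀ h1σ]; linarith
  have hb₁ : (1 - ε) / (1 + r * s) ≤ b' := by
    rw [div_le_iff₀ hrs]; linarith
  have h1ε : 0 < 1 - ε := by linarith
  have ha0 : 0 < a' := lt_of_lt_of_le (by positivity) ha₁
  refine ⟨f', L', c', a', b', m', B', ?_, hf', ha0, hb', hm', ?_, ?_, ?_, ?_⟩
  · refine le_trans (mul_le_mul_of_nonneg_right ?_ B.L_pos.le) hL'
    simpa using pow_le_pow_right₀ one_le_two hk
  · linarith [mul_lt_mul_of_pos_right hσs ha0]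
  · have hδ : a' = (1 - (1 - (1 - σ) * a')) / (1 - σ) := by field_simp; ring
    have hδ0 : 0 ≤ 1 - (1 - σ) * a' := by linarith
    have hb₂ : b' ≤ (1 + r * (1 - (1 - σ) * a')) / (1 + r * σ) := by
      rw [le_div_iff₀ hrσ]; linarith
    have hδε : 1 - (1 - σ) * a' ≤ ε := by linarith
    generalize 1 - (1 - σ) * a' = δ at *
    have h1 := mul_le_mul_of_nonneg_left hb₂ hrs.le
    have h2 : r * (1 - s) * ((1 - δ) / (1 - σ)) - r * (1 - s) * ((1 - ε) / (1 - σ)) ≤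
        r * (ε - δ) := by
      have : r * (1 - s) * ((1 - δ) / (1 - σ)) - r * (1 - s) * ((1 - ε) / (1 - σ)) =
        r * (ε - δ) * ((1 - s) / (1 - σ)) := by ring
      rw [this]
      exact mul_le_of_le_one_right (mul_nonneg hr.le (by linarith))
        ((div_le_one h1σ).2 (by linarith))
    have h3 : r * (ε - δ) ≤ (1 + r * s) * ((1 + r * ε) / (1 + r * σ)) -
        (1 + r * s) * ((1 + r * δ) / (1 + r * σ)) := by
      have : (1 + r * s) * ((1 + r * ε) / (1 + r * σ)) -
        (1 + r * s) * ((1 + r * δ) / (1 + r * σ)) =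
        r * (ε - δ) * ((1 + r * s) / (1 + r * σ)) := by ring
      rw [this]
      exact le_mul_of_one_le_right (mul_nonneg hr.le (by linarith))
        ((one_le_div hrσ).2 (by gcongr))
    rw [hδ]
    linarith
  · refine hεQ.trans_le ?_
    gcongr
  · have : a' ^ q ≤ (1 / (1 - s)) ^ q := by
      gcongr
      exact ha₂.trans (by gcongr)
    have := mul_le_mul_of_nonneg_left this hN
    linarith

/-! ### Passing to the limit -/

/-- Existence of a block structure on `(f, L)` whose mean values lie in the interior of the
admissible region. -/
def IsExtendable (r q Q s : ℝ) (f : ℝ → ℝ) (L : ℝ) : Prop :=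
  ∃ c a b m, Block r q Q f L c a b m ∧ 0 < b ∧ 0 < m ∧ (1 - s) * a < 1 ∧
    r * (1 - s) * a + (1 + r * s) * b < r + 1

theorem block_one {r q Q : ℝ} (hr : 0 < r) (hQ : 1 < Q) : Block r q Q (fun _ => 1) 1 1 1 1 1 := by
  have hT : ∀ T : ℝ, 0 ≤ T → Admissible r Q T T T := fun T hT => by
    have : T ^ (1 + 1 / r) = T * T ^ (1 / r) := by
      rw [Real.rpow_add' hT (by positivity), Real.rpow_one]
    unfold Admissible
    rw [this]
    exact le_mul_of_one_le_left (by positivity) hQ.le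
  refine ⟨one_pos, one_pos, fun _ => rfl, measurable_const, ⟨1, 1, one_pos, fun _ => by simp⟩,
    fun s t hst => ?_, fun x y hx hy => ?_, fun x y hx hy => ?_, by simp, by simp, by simp⟩
  · simpa using hT (t - s) (by linarith)
  · simpa using hT (x + y) (by linarith)
  · simpa using hT (x + y) (by linarith)

theorem exists_isExtendable {r q Q s : ℝ} (hr : 0 < r) (hQ : 1 < Q) (hs0 : 0 < s) (hs1 : s < 1)
    (hs : (1 - s) * (1 + r * s) ^ (1 / r) = 1 / Q) : ∃ f L, IsExtendable r q Q s f L := by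
  obtain ⟨σ, hσ0, hσs⟩ := exists_between hs0
  obtain ⟨K, hK, hKQ⟩ := exists_one_lt_rpow_le hr (by linarith) hs1 hs hσ0 hσs
  obtain ⟨l, hl0, hl1, -, -, htri⟩ := exists_step_size hr hσs hK one_pos
  obtain ⟨f, L, B, -, -⟩ := (block_one (q := q) hr hQ).exists_step hr hσ0 (by linarith) hl0 hl1 hK
    hKQ (by linarith) htri
  have hσl : σ * l < s := by nlinarith
  have hτ : 0 < σ * l := by positivity
  have hθ : 0 < 1 - σ * l := by linarith
  have hrτ : 0 < 1 + r * (σ * l) := by positivity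
  have h1s : 0 < 1 - s := by linarith
  have hb : (1 - σ * l) ^ r ≤ 1 / (1 + r * (σ * l)) := by
    have := one_add_mul_le_one_sub_rpow_neg hr.le (show σ * l < 1 by linarith)
    rw [Real.rpow_neg hθ.le] at this
    rw [one_div]
    exact le_inv_of_le_inv₀ hrτ this
  rw [show l + (1 - l) * 1 = 1 by ring, one_mul, one_mul] at B
  refine ⟨f, L, _, _, _, _, B, Real.rpow_pos_of_pos hθ _, Real.rpow_pos_of_pos hθ _, ?_, ?_⟩
  · rw [mul_one_div, div_lt_one hθ]
    linarith
  · have h1 := mul_le_mul_of_nonneg_left hb (show 0 ≤ 1 + r * s by positivity)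
    generalize σ * l = τ at *
    have e : r + 1 - (r * (1 - s) * (1 / (1 - τ)) + (1 + r * s) * (1 / (1 + r * τ))) =
        r * (s - τ) * (τ * (r + 1)) / ((1 - τ) * (1 + r * τ)) := by
      field_simp
      ring
    have : 0 < r * (s - τ) * (τ * (r + 1)) / ((1 - τ) * (1 + r * τ)) := by
      have : 0 < s - τ := by linarith
      positivity
    linarith

theorem IsExtendable.exists_extension {r q Q s : ℝ} {f : ℝ → ℝ} {L : ℝ}
    (h : IsExtendable r q Q s f L) (hr : 0 < r) (hQ : 0 < Q) (hs0 : 0 < s) (hs1 : s < 1)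
    (hqs : q * s = 1) (hs : (1 - s) * (1 + r * s) ^ (1 / r) = 1 / Q) {Q' N : ℝ} (hQ' : Q' < Q)
    (hN : 0 ≤ N) :
    ∃ f' L', IsExtendable r q Q s f' L' ∧ 2 * L ≤ L' ∧
      (∀ x ∈ Ico (-(L / 2)) (L / 2), f' x = f x) ∧
      0 < (∫ x in (-(L' / 2))..(L' / 2), f' x) / L' ∧
      Q' < (∫ x in (-(L' / 2))..(L' / 2), f' x) / L' *
        ((∫ x in (-(L' / 2))..(L' / 2), f' x ^ (-r)) / L') ^ (1 / r) ∧
      N * ((∫ x in (-(L' / 2))..(L' / 2), f' x) / L') ^ q ≤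
        (∫ x in (-(L' / 2))..(L' / 2), f' x ^ q) / L' := by
  obtain ⟨c, a, b, m, B, hb, hm, ha, hab⟩ := h
  obtain ⟨f', L', c', a', b', m', B', hL', hf', ha0, hb', hm', ha', hab', hQ'', hN'⟩ :=
    B.exists_extension hr hQ hs0 hs1 hqs hs hb hm ha hab hQ' hN
  have hL := B'.L_pos
  have hc := B'.c_pos
  have hper : ∀ g : ℝ → ℝ, Function.Periodic g L' →
      ∫ x in (-(L' / 2))..(L' / 2), g x = ∫ x in (0 : ℝ)..L', g x := fun g hg => by
    have := hg.intervalIntegral_add_eq (-(L' / 2)) 0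
    rwa [zero_add, show -(L' / 2) + L' = L' / 2 by ring] at this
  refine ⟨f', L', ⟨c', a', b', m', B', hb', hm', ha', hab'⟩, hL', hf', ?_⟩
  rw [hper _ B'.periodic, hper (fun x => f' x ^ (-r)) (B'.periodic.comp fun v => v ^ (-r)),
    hper (fun x => f' x ^ q) (B'.periodic.comp fun v => v ^ q), B'.mean, B'.mean_neg, B'.mean_pow,
    mul_div_cancel_right₀ _ hL.ne', mul_div_cancel_right₀ _ hL.ne', mul_div_cancel_right₀ _ hL.ne']
  refine ⟨by positivity, ?_, ?_⟩
  · have e : a' * c' * (b' * c' ^ (-r)) ^ (1 / r) = a' * b' ^ (1 / r) := by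
      rw [Real.mul_rpow hb'.le (by positivity), ← Real.rpow_mul hc.le,
        show -r * (1 / r) = -1 by field_simp, Real.rpow_neg_one]
      field_simp
    rwa [e]
  · rw [Real.mul_rpow ha0.le hc.le, ← mul_assoc]
    gcongr

theorem exists_measurable_gluing {F : ℕ → ℝ → ℝ} {L : ℕ → ℝ} (hF : ∀ n, Measurable (F n))
    (hL0 : 0 < L 0) (hL : ∀ n, 2 * L n ≤ L (n + 1))
    (hagree : ∀ n, ∀ x ∈ Ico (-(L n / 2)) (L n / 2), F (n + 1) x = F n x) :
    ∃ w : ℝ → ℝ, Measurable w ∧ (∀ n, ∀ x ∈ Ico (-(L n / 2)) (L n / 2), w x = F n x) ∧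
      Tendsto L atTop atTop := by
  have hpow : ∀ n, 2 ^ n * L 0 ≤ L n := fun n => by
    induction n with
    | zero => simp
    | succ n ih => rw [pow_succ]; linarith [hL n]
  have hpos : ∀ n, 0 < L n := fun n => lt_of_lt_of_le (by positivity) (hpow n)
  have hLmono : Monotone L := monotone_nat_of_le_succ fun n => by linarith [hL n, hpos n]
  have hLtop : Tendsto L atTop atTop := tendsto_atTop_mono hpow
    ((tendsto_pow_atTop_atTop_of_one_lt one_lt_two).atTop_mul_const hL0)
  have hag : ∀ n k, n ≤ k → ∀ x ∈ Ico (-(L n / 2)) (L n / 2), F k x = F n x := by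
    intro n k hk x hx
    induction k, hk using Nat.le_induction with
    | base => rfl
    | succ k hk ih =>
      have := hLmono hk
      rw [hagree k x ⟨by linarith [hx.1], by linarith [hx.2]⟩, ih]
  have hex : ∀ x : ℝ, ∃ n, x ∈ Ico (-(L n / 2)) (L n / 2) := fun x => by
    obtain ⟨n, hn⟩ := (hLtop.eventually_gt_atTop (2 * |x|)).exists
    exact ⟨n, by linarith [neg_abs_le x], by linarith [le_abs_self x]⟩
  choose N hN using hex
  have hw : ∀ n, ∀ x ∈ Ico (-(L n / 2)) (L n / 2), F (N x) x = F n x := fun n x hx => by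
    rcases le_total n (N x) with h | h
    · exact hag _ _ h x hx
    · exact (hag _ _ h x (hN x)).symm
  refine ⟨fun x => F (N x) x, measurable_of_tendsto_metrizable hF (tendsto_pi_nhds.2 fun x => ?_),
    hw, hLtop⟩
  exact tendsto_const_nhds.congr' <| (eventually_ge_atTop (N x)).mono fun k hk =>
    (hag _ _ hk x (hN x)).symm

theorem exists_extremal_weight {r q Q s : ℝ} (hr : 0 < r) (hQ : 1 < Q) (hs0 : 0 < s) (hs1 : s < 1)
    (hqs : q * s = 1) (hs : (1 - s) * (1 + r * s) ^ (1 / r) = 1 / Q) :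
    ∃ w : ℝ → ℝ, Measurable w ∧ (∀ x, 0 < w x) ∧
      (∀ e s t : ℝ, IntervalIntegrable (fun x => w x ^ e) volume s t) ∧
      (∀ s t, s ≤ t → Admissible r Q (∫ x in s..t, w x) (∫ x in s..t, w x ^ (-r)) (t - s)) ∧
      ∀ Q' < Q, ∀ N : ℝ, ∃ T > 0, 0 < (∫ x in (-(T / 2))..(T / 2), w x) / T ∧
        Q' < (∫ x in (-(T / 2))..(T / 2), w x) / T *
          ((∫ x in (-(T / 2))..(T / 2), w x ^ (-r)) / T) ^ (1 / r) ∧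
        N * ((∫ x in (-(T / 2))..(T / 2), w x) / T) ^ q ≤
          (∫ x in (-(T / 2))..(T / 2), w x ^ q) / T := by
  have hstep : ∀ (n : ℕ) (y : {y : (ℝ → ℝ) × ℝ // IsExtendable r q Q s y.1 y.2}), _ := fun n y =>
    y.2.exists_extension hr (by linarith) hs0 hs1 hqs hs (Q' := Q - 1 / (n + 1)) (N := n)
      (sub_lt_self _ (by positivity)) (by positivity)
  choose f' L' hext hL hagree hU hQ' hN' using hstep
  obtain ⟨f₀, L₀, h₀⟩ := exists_isExtendable (q := q) hr hQ hs0 hs1 hs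
  let Y : ℕ → {y : (ℝ → ℝ) × ℝ // IsExtendable r q Q s y.1 y.2} :=
    Nat.rec ⟨(f₀, L₀), h₀⟩ fun n y => ⟨(f' n y, L' n y), hext n y⟩
  have hblock : ∀ n, ∃ c a b m, Block r q Q (Y n).1.1 (Y n).1.2 c a b m := fun n => by
    obtain ⟨c, a, b, m, B, -⟩ := (Y n).2
    exact ⟨c, a, b, m, B⟩
  choose c a b m B using hblock
  obtain ⟨w, hwm, hw, hLtop⟩ := exists_measurable_gluing (F := fun n => (Y n).1.1)
    (L := fun n => (Y n).1.2) (fun n => (B n).measurable) (B 0).L_pos (fun n => hL n (Y n))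
    (fun n => hagree n (Y n))
  have hcover : ∀ R : ℝ, ∃ n, R < (Y n).1.2 / 2 := fun R => by
    obtain ⟨n, hn⟩ := (hLtop.eventually_gt_atTop (2 * R)).exists
    exact ⟨n, by linarith⟩
  have hcover2 : ∀ s t : ℝ, ∃ n, ∀ x ∈ uIcc s t, w x = (Y n).1.1 x := fun s t => by
    obtain ⟨n, hn⟩ := hcover (max |s| |t|)
    refine ⟨n, fun x hx => hw n x ?_⟩
    have := abs_le_max_abs_abs hx.1 hx.2
    have h2 : |s ⊓ t| ≤ max |s| |t| := by rcases le_total s t with h | h <;> simp [h]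
    have h3 : |s ⊔ t| ≤ max |s| |t| := by rcases le_total s t with h | h <;> simp [h]
    have h4 := abs_lt.1 ((this.trans (max_le h2 h3)).trans_lt hn)
    exact ⟨h4.1.le, h4.2⟩
  refine ⟨w, hwm, fun x => ?_, fun e s t => ?_, fun s t hst => ?_, fun Q' hQ'' N => ?_⟩
  · obtain ⟨n, hn⟩ := hcover2 x x
    obtain ⟨lo, hi, hlo, hb⟩ := (B n).bounds
    rw [hn x (by simp)]
    exact hlo.trans_le (hb x).1
  · obtain ⟨n, hn⟩ := hcover2 s t
    refine (intervalIntegrable_rpow_of_bounds (B n).measurable (B n).bounds e s t).congr_uIoo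
      fun x hx => ?_
    rw [hn x (Ioo_subset_Icc_self hx)]
  · obtain ⟨n, hn⟩ := hcover2 s t
    rw [intervalIntegral.integral_congr (g := (Y n).1.1) hn,
      intervalIntegral.integral_congr (f := fun x => w x ^ (-r))
        (g := fun x => (Y n).1.1 x ^ (-r)) fun x hx => by
        simp only [hn x hx]]
    exact (B n).admissible s t hst
  · obtain ⟨n, hn⟩ := exists_nat_gt (max N (1 / (Q - Q')))
    have hnN : N ≤ n := (le_max_left _ _).trans hn.le
    have hnQ : Q' ≤ Q - 1 / (n + 1) := by
      have h1 : 0 < Q - Q' := by linarith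
      have h2 : 1 / (Q - Q') < n := (le_max_right _ _).trans_lt hn
      have : 1 / ((n : ℝ) + 1) ≤ Q - Q' := by
        rw [div_lt_iff₀ h1] at h2
        rw [div_le_iff₀ (by positivity)]
        linarith
      linarith
    have hpos := (B (n + 1)).L_pos
    have heq : EqOn w (Y (n + 1)).1.1 (Ioo (-((Y (n + 1)).1.2 / 2)) ((Y (n + 1)).1.2 / 2)) :=
      fun x hx => hw (n + 1) x (Ioo_subset_Ico_self hx)
    refine ⟨(Y (n + 1)).1.2, hpos, ?_⟩
    have hle : -((Y (n + 1)).1.2 / 2) ≤ (Y (n + 1)).1.2 / 2 := by linarith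
    rw [intervalIntegral.integral_congr_Ioo_of_le hle heq,
      intervalIntegral.integral_congr_Ioo_of_le (f := fun x => w x ^ (-r))
        (g := fun x => (Y (n + 1)).1.1 x ^ (-r)) hle
        fun x hx => by simp only [heq hx],
      intervalIntegral.integral_congr_Ioo_of_le (f := fun x => w x ^ q)
        (g := fun x => (Y (n + 1)).1.1 x ^ q) hle
        fun x hx => by simp only [heq hx]]
    refine ⟨hU n (Y n), hnQ.trans_lt (hQ' n (Y n)), le_trans ?_ (hN' n (Y n))⟩
    have := Real.rpow_nonneg (hU n (Y n)).le q
    exact mul_le_mul_of_nonneg_right hnN this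

theorem intAvg_eq_intervalIntegral_div {a b : ℝ} (hab : a ≤ b) (f : ℝ → ℝ) :
    intAvg a b f = (∫ x in a..b, f x) / (b - a) := by
  rw [intAvg, setAverage_eq, Real.volume_real_Ioo_of_le hab, smul_eq_mul,
    intervalIntegral.integral_of_le hab, integral_Ioc_eq_integral_Ioo, div_eq_inv_mul]

/-- Sharpness of the range `1 ≤ q < 1/s⁺_{p1}(Q)` in `A_p ⊂ RH_q` on the
real line: there is a weight with `[w]_p = Q` and `[w]_{RH_{q₀}} = ∞` for `q₀ = 1/s⁺_{p1}(Q)`. -/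
theorem Ap_to_RHq_sharpness
    (p Q p1 : ℝ) (hp : 1 < p) (hQ : 1 < Q) (hp1 : p1 = -1 / (p - 1))
    (sp : ℝ) (hsp_mem : sp ∈ Icc (0:ℝ) 1)
    (hsp : (1 - sp) * (1 - p1 * sp) ^ (-1 / p1) = 1 / Q)
    (q₀ : ℝ) (hq₀ : q₀ = 1 / sp) :
    ∃ w : ℝ → ℝ, Measurable w ∧ (∀ᵐ x ∂(volume : Measure ℝ), 0 < w x) ∧
      MemAp w p Q ∧
      (∀ Q' : ℝ, Q' < Q → ∃ a b : ℝ, a < b ∧ Q' < ApChar w p a b) ∧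
      ¬ ∃ C : ℝ, MemRH w q₀ C := by
  obtain ⟨r, hr⟩ : ∃ r, r = 1 / (p - 1) := ⟨_, rfl⟩
  have hp' : 0 < p - 1 := by linarith
  have hr0 : 0 < r := by rw [hr]; positivity
  have hpr : p - 1 = 1 / r := by rw [hr, one_div_one_div]
  have hp1r : -1 / (p - 1) = -r := by rw [hr, neg_div]
  have hs0 : 0 < sp := by
    refine lt_of_le_of_ne hsp_mem.1 fun h => ?_
    rw [← h] at hsp
    simp only [sub_zero, mul_zero, Real.one_rpow, mul_one] at hsp
    rw [eq_div_iff (by linarith)] at hsp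
    linarith
  have hs1 : sp < 1 := by
    refine lt_of_le_of_ne hsp_mem.2 fun h => ?_
    rw [h, sub_self, zero_mul] at hsp
    have : 0 < 1 / Q := by positivity
    linarith
  have hs : (1 - sp) * (1 + r * sp) ^ (1 / r) = 1 / Q := by
    rwa [hp1, hp1r, neg_mul, sub_neg_eq_add, neg_div_neg_eq] at hsp
  have hqs : q₀ * sp = 1 := by rw [hq₀]; field_simp
  have hq0 : 0 < q₀ := by rw [hq₀]; positivity
  obtain ⟨w, hwm, hw0, hwi, hwA, hwE⟩ := exists_extremal_weight hr0 hQ hs0 hs1 hqs hs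
  have hAp : ∀ a b, a < b → ApChar w p a b =
      (∫ x in a..b, w x) / (b - a) * ((∫ x in a..b, w x ^ (-r)) / (b - a)) ^ (1 / r) := by
    intro a b hab
    rw [ApChar, hp1r, hpr, intAvg_eq_intervalIntegral_div hab.le,
      intAvg_eq_intervalIntegral_div hab.le]
  have hint : ∀ e a b : ℝ, a < b → IntegrableOn (fun x => w x ^ e) (Ioo a b) := fun e a b hab =>
    (intervalIntegrable_iff_integrableOn_Ioo_of_le hab.le).1 (hwi e a b)
  refine ⟨w, hwm, ae_of_all _ hw0, fun a b hab => ⟨?_, ?_, ?_⟩, fun Q' hQ' => ?_, ?_⟩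
  · simpa using hint 1 a b hab
  · exact hint _ a b hab
  · rw [hAp a b hab]
    have hT : 0 < b - a := by linarith
    have hV : 0 ≤ ∫ x in a..b, w x ^ (-r) :=
      intervalIntegral.integral_nonneg hab.le fun x _ => Real.rpow_nonneg (hw0 x).le _
    have h := hwA a b hab.le
    rw [Admissible, Real.rpow_add hT, Real.rpow_one] at h
    rw [Real.div_rpow hV hT.le, div_mul_div_comm]
    exact (div_le_iff₀ (by positivity)).2 h
  · obtain ⟨T, hT, -, h, -⟩ := hwE Q' hQ' 0
    have hlt : -(T / 2) < T / 2 := by linarith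
    refine ⟨_, _, hlt, ?_⟩
    rw [hAp _ _ hlt, show T / 2 - -(T / 2) = T by ring]
    exact h
  · rintro ⟨C, hC⟩
    obtain ⟨T, hT, hU, -, h⟩ := hwE 0 (by linarith) ((|C| + 1) ^ q₀)
    have hlt : -(T / 2) < T / 2 := by linarith
    have hRH := (hC _ _ hlt).2.2
    rw [RHChar, intAvg_eq_intervalIntegral_div hlt.le, intAvg_eq_intervalIntegral_div hlt.le,
      show T / 2 - -(T / 2) = T by ring, ← div_eq_mul_inv, div_le_iff₀ hU] at hRH
    rw [← Real.mul_rpow (by positivity) hU.le] at h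
    have h2 := Real.rpow_le_rpow (by positivity) h (show 0 ≤ 1 / q₀ by positivity)
    rw [← Real.rpow_mul (by positivity), mul_one_div_cancel hq0.ne', Real.rpow_one] at h2
    have h3 := le_of_mul_le_mul_right (h2.trans hRH) hU
    linarith [le_abs_self C]
end
end

section
/- Let p>1 and Q>1. Let q satisfy 1 - s⁻_p(Q) < q < ∞. Then there is a constant C = C(p,q,Q), independent of the dimension n and of the measure μ, such that: for every n ≥ 1, every Radon measure μ on ℝⁿ with μ(H) = 0 for every hyperplane H orthogonal to one of the coordinate axes, and every weight w with strong Reverse Hölder characteristic [w]_{RH_p} ≤ Q, one has [w]_q ≤ C; in particular w belongs to the strong Muckenhoupt class A_q* with respect to μ. -/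
open MeasureTheory Set Filter

noncomputable section

/-- An axis-parallel open rectangular box in `ℝⁿ` (modelled as `Fin n → ℝ`). -/
def IsBox {n : ℕ} (R : Set (Fin n → ℝ)) : Prop :=
  ∃ a b : Fin n → ℝ, (∀ i, a i < b i) ∧ R = univ.pi fun i => Ioo (a i) (b i)

/-- The average `⟨f⟩_R = (1/μ(R)) ∫_R f dμ`. -/
def boxAvg {n : ℕ} (μ : Measure (Fin n → ℝ)) (R : Set (Fin n → ℝ))
    (f : (Fin n → ℝ) → ℝ) : ℝ :=
  ⨍ x in R, f x ∂μ

/-- Every hyperplane orthogonal to one of the coordinate axes is `μ`-null. -/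
def NullHyperplanes {n : ℕ} (μ : Measure (Fin n → ℝ)) : Prop :=
  ∀ (i : Fin n) (c : ℝ), μ {x | x i = c} = 0

/-- `[w]_p ≤ Q`: the strong Muckenhoupt characteristic of `w` w.r.t. `μ` is at most `Q`;
this includes the requisite integrability of `w` and `w^{-1/(p-1)}` on every box. -/
def ApBound {n : ℕ} (μ : Measure (Fin n → ℝ)) (w : (Fin n → ℝ) → ℝ) (p Q : ℝ) : Prop :=
  ∀ R : Set (Fin n → ℝ), IsBox R → 0 < μ R → μ R < ⊤ →
    IntegrableOn w R μ ∧ IntegrableOn (fun x => w x ^ (-1 / (p - 1))) R μ ∧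
    boxAvg μ R w * (boxAvg μ R fun x => w x ^ (-1 / (p - 1))) ^ (p - 1) ≤ Q

/-- `[w]_{RH_p} ≤ Q`: the strong Reverse Hölder characteristic of `w` w.r.t. `μ` is
at most `Q`, i.e. `⟨w^p⟩_R^{1/p} ≤ Q⟨w⟩_R` on every box. -/
def RHBound {n : ℕ} (μ : Measure (Fin n → ℝ)) (w : (Fin n → ℝ) → ℝ) (p Q : ℝ) : Prop :=
  ∀ R : Set (Fin n → ℝ), IsBox R → 0 < μ R → μ R < ⊤ →
    IntegrableOn w R μ ∧ IntegrableOn (fun x => w x ^ p) R μ ∧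
    (boxAvg μ R fun x => w x ^ p) ^ (1 / p) ≤ Q * boxAvg μ R w

theorem mul_rpow_sub_le_rpow {p : ℝ} (hp : 1 ≤ p) {w z : ℝ} (hw : 0 ≤ w) (hz : 0 < z) :
    p * z ^ (p - 1) * w - (p - 1) * z ^ p ≤ w ^ p := by
  have h := one_add_mul_self_le_rpow_one_add (s := w / z - 1) (by
    have : 0 ≤ w / z := by positivity
    linarith) hp
  rw [add_sub_cancel, Real.div_rpow hw hz.le, le_div_iff₀ (by positivity)] at h
  have h1 : z ^ p = z ^ (p - 1) * z := by
    rw [← Real.rpow_add_one hz.ne']; ring_nf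
  have h2 : (1 + p * (w / z - 1)) * z ^ p = p * z ^ (p - 1) * w - (p - 1) * z ^ p := by
    rw [h1]; field_simp; ring
  linarith

theorem rpow_one_add_gt {p Q α a : ℝ} (hp : 1 < p) (hα : 0 ≤ α) (ha : α < a) (hQ : 0 < Q)
    (h : (1 + α) ^ p = Q * (1 + p * α)) : Q * (1 + p * a) < (1 + a) ^ p := by
  have hα1 : 0 < 1 + α := by linarith
  have hs : 0 < (a - α) / (1 + α) := div_pos (by linarith) hα1
  have h1 := one_add_mul_self_lt_rpow_one_add (s := (a - α) / (1 + α)) (by linarith) hs.ne' hp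
  have h2 : 1 + a = (1 + α) * (1 + (a - α) / (1 + α)) := by field_simp; ring
  rw [h2, Real.mul_rpow hα1.le (by linarith), h, mul_assoc]
  refine mul_lt_mul_of_pos_left ?_ hQ
  have hpα : 0 < 1 + p * α := by positivity
  refine lt_of_le_of_lt ?_ (mul_lt_mul_of_pos_left h1 hpα)
  have h3 : a - α ≤ (1 + p * α) * ((a - α) / (1 + α)) := by
    rw [mul_div_assoc', le_div_iff₀ hα1]
    nlinarith [mul_nonneg (sub_nonneg.2 ha.le) (mul_nonneg (sub_nonneg.2 hp.le) hα)]
  nlinarith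

/-- Coefficients for which the linear functional `A μ(R) + B ∫_R w ^ p` dominates the negative
power integral along a stopping-time decomposition with ratio `l`. -/
theorem exists_coefficients {p r K : ℝ} (hp : 1 < p) (hr : 0 < r)
    (h : K * (1 + p * (1 / r)) < (1 + 1 / r) ^ p) :
    ∃ l A B Y : ℝ, 0 < l ∧ l < 1 ∧ 0 ≤ B ∧ 0 < Y ∧ 1 ≤ A + B ∧
      l ^ (-r) ≤ A + B * (p * Y ^ (p - 1) - (p - 1) * Y ^ p) ∧
      A * (l ^ (-r) - 1) + B * (l ^ (-p - r) - 1) * (K * l ^ p)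
        ≤ B * (p * Y ^ (p - 1) * (1 - l)) := by
  obtain ⟨Y, hY⟩ : ∃ Y, Y = 1 + 1 / r := ⟨_, rfl⟩
  have hY0 : 0 < Y := by rw [hY]; positivity
  have hYr : r * Y = r + 1 := by rw [hY]; field_simp
  obtain ⟨Z, hZ⟩ : ∃ Z, Z = Y ^ (p - 1) := ⟨_, rfl⟩
  have hYp : Y ^ p = Z * Y := by
    rw [hZ, ← Real.rpow_add_one hY0.ne']; ring_nf
  rw [← hY, hYp] at h
  have hD : 0 < Z * (1 + r) - (p + r) * K := by
    have h1 := mul_lt_mul_of_pos_left h hr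
    have h2 : r * (K * (1 + p * (1 / r))) = (p + r) * K := by field_simp; ring
    have h3 : r * (Z * Y) = Z * (1 + r) := by rw [mul_left_comm, hYr]; ring
    linarith
  obtain ⟨D, hDd⟩ : ∃ D, D = Z * (1 + r) - (p + r) * K := ⟨_, rfl⟩
  rw [← hDd] at hD
  obtain ⟨B, hB⟩ : ∃ B, B = 2 * r / D := ⟨_, rfl⟩
  have hB0 : 0 ≤ B := by rw [hB]; positivity
  have hBD : B * D = 2 * r := by rw [hB]; field_simp
  obtain ⟨T, hT⟩ : ∃ T, T = p * Z - (p - 1) * (Z * Y) := ⟨_, rfl⟩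
  have hT1 : T ≤ 1 := by
    have := mul_rpow_sub_le_rpow hp.le zero_le_one hY0
    rw [Real.one_rpow, hYp, ← hZ] at this
    linarith
  have hd1 : ∀ s : ℝ, HasDerivAt (fun l : ℝ => l ^ s) s 1 := fun s => by
    simpa using Real.hasDerivAt_rpow_const (x := 1) (p := s) (Or.inl one_ne_zero)
  have hder : HasDerivAt (fun l : ℝ => B * (p * Z * (1 - l)) - (l ^ (-r) - B * T) * (l ^ (-r) - 1)
      - B * (l ^ (-r) - l ^ p) * K) (-r) 1 := by
    have := ((((hasDerivAt_id (1:ℝ)).const_sub 1).const_mul (p * Z)).const_mul B).sub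
      (((hd1 (-r)).sub_const (B * T)).mul ((hd1 (-r)).sub_const 1))
    have := this.sub ((((hd1 (-r)).sub (hd1 p)).const_mul B).mul_const K)
    refine (this.congr_deriv ?_)
    simp only [Real.one_rpow]
    have e : B * (p * Z * -1) - (-r * (1 - 1) + (1 - B * T) * -r) - B * (-r - p) * K
      = r - B * (p * Z + r * T - (p + r) * K) := by ring
    have e2 : p * Z + r * T - (p + r) * K = D := by
      rw [hT, hDd]
      linear_combination -(p - 1) * Z * hYr
    rw [e, e2, hBD]; ring
  have hev := (hasDerivAt_iff_tendsto_slope_left_right.1 hder).1.eventually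
    (gt_mem_nhds (show -r < 0 by linarith))
  obtain ⟨l, hl, hl1, hl0⟩ := (hev.and ((eventually_mem_nhdsWithin (a := (1:ℝ))
    (s := Iio 1)).and (eventually_nhdsWithin_of_eventually_nhds (lt_mem_nhds one_pos)))).exists
  have hl1 : l < 1 := hl1
  have hl0 : 0 < l := hl0
  rw [slope_def_field, div_neg_iff] at hl
  rcases hl with hl | hl
  swap
  · linarith
  have hl := hl.1
  simp only [Real.one_rpow, sub_self, mul_zero, zero_mul] at hl
  have hlp : l ^ (-p - r) * l ^ p = l ^ (-r) := by
    rw [← Real.rpow_add hl0]; ring_nf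
  have hlr : 1 ≤ l ^ (-r) := Real.one_le_rpow_of_pos_of_le_one_of_nonpos hl0 hl1.le (by linarith)
  refine ⟨l, l ^ (-r) - B * T, B, Y, hl0, hl1, hB0, hY0, ?_, ?_, ?_⟩
  · nlinarith
  · rw [hYp, ← hZ, ← hT]; linarith
  · rw [← hZ]
    have : B * (l ^ (-p - r) - 1) * (K * l ^ p) = B * (l ^ (-r) - l ^ p) * K := by
      rw [← hlp]; ring
    rw [this]; linarith

theorem integrable_and_integral_le_of_tendsto {α : Type*} [MeasurableSpace α] {μ : Measure α}
    {g : ℕ → α → ℝ} {h : α → ℝ} {C : ℝ} (hg : ∀ N, Integrable (g N) μ)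
    (hg0 : ∀ N, 0 ≤ᵐ[μ] g N) (hgC : ∀ N, ∫ x, g N x ∂μ ≤ C)
    (hlim : ∀ᵐ x ∂μ, Tendsto (fun N => g N x) atTop (nhds (h x))) :
    Integrable h μ ∧ ∫ x, h x ∂μ ≤ C := by
  have hh0 : 0 ≤ᵐ[μ] h := by
    filter_upwards [hlim, ae_all_iff.2 hg0] with x hx hx0
    exact ge_of_tendsto' hx hx0
  have hhm : AEStronglyMeasurable h μ :=
    aestronglyMeasurable_of_tendsto_ae _ (fun N => (hg N).aestronglyMeasurable) hlim
  have hC : 0 ≤ C := (integral_nonneg_of_ae (hg0 0)).trans (hgC 0)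
  have hle : ∫⁻ x, ENNReal.ofReal (h x) ∂μ ≤ ENNReal.ofReal C := by
    calc ∫⁻ x, ENNReal.ofReal (h x) ∂μ
        = ∫⁻ x, liminf (fun N => ENNReal.ofReal (g N x)) atTop ∂μ := by
          refine lintegral_congr_ae ?_
          filter_upwards [hlim] with x hx
          exact ((ENNReal.tendsto_ofReal hx).liminf_eq).symm
      _ ≤ liminf (fun N => ∫⁻ x, ENNReal.ofReal (g N x) ∂μ) atTop :=
          lintegral_liminf_le' fun N => (hg N).aestronglyMeasurable.aemeasurable.ennreal_ofReal
      _ ≤ ENNReal.ofReal C := by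
          refine liminf_le_of_le (by isBoundedDefault) fun b hb => ?_
          obtain ⟨N, hN⟩ := hb.exists
          rw [← ofReal_integral_eq_lintegral_ofReal (hg N) (hg0 N)] at hN
          exact hN.trans (ENNReal.ofReal_le_ofReal (hgC N))
  refine ⟨⟨hhm, ?_⟩, ?_⟩
  · rw [hasFiniteIntegral_iff_ofReal hh0]
    exact hle.trans_lt ENNReal.ofReal_lt_top
  · rw [integral_eq_lintegral_of_nonneg_ae hh0 hhm]
    exact ENNReal.toReal_le_of_le_ofReal hC hle

theorem rpow_neg_add_mul_rpow {t : ℝ} (ht : 0 < t) (p r : ℝ) :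
    t ^ (-p - r) * t ^ p = t ^ (-r) := by
  rw [← Real.rpow_add ht]; ring_nf

/-- Passing from a set to a stopping set inside it on which the average of `w` has dropped from `t`
to `l * t`. -/
theorem setIntegral_stopping_step {α : Type*} [MeasurableSpace α] {μ : Measure α}
    {p r K l A B Y t : ℝ} (hp : 1 < p) (hr : 0 < r) (hl : 0 < l) (hl1 : l < 1) (hB : 0 ≤ B)
    (hY : 0 < Y) (ht : 0 < t)
    (hA : l ^ (-r) ≤ A + B * (p * Y ^ (p - 1) - (p - 1) * Y ^ p))
    (hA' : A * (l ^ (-r) - 1) + B * (l ^ (-p - r) - 1) * (K * l ^ p)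
      ≤ B * (p * Y ^ (p - 1) * (1 - l)))
    {s e : Set α} (hs : MeasurableSet s) (he : MeasurableSet e) (hes : e ⊆ s) (hμs : μ s ≠ ⊤)
    {w g : α → ℝ} (hw0 : ∀ᵐ x ∂μ, 0 < w x) (hw : IntegrableOn w s μ)
    (hwp : IntegrableOn (fun x => w x ^ p) s μ) (hg : IntegrableOn g s μ)
    (hgw : ∀ᵐ x ∂μ, g x ≤ w x ^ (-r))
    (h1 : ∫ x in s, w x ∂μ = t * μ.real s) (h2 : ∫ x in e, w x ∂μ = l * t * μ.real e)
    (h3 : ∫ x in e, w x ^ p ∂μ ≤ K * (l * t) ^ p * μ.real e)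
    (h4 : ∀ᵐ x ∂μ, x ∈ s → x ∉ e → l * t ≤ w x)
    (h5 : ∫ x in e, g x ∂μ
      ≤ A * (l * t) ^ (-r) * μ.real e + B * (l * t) ^ (-p - r) * ∫ x in e, w x ^ p ∂μ) :
    ∫ x in s, g x ∂μ ≤ A * t ^ (-r) * μ.real s + B * t ^ (-p - r) * ∫ x in s, w x ^ p ∂μ := by
  have hds : s \ e ⊆ s := sdiff_subset
  have hd : MeasurableSet (s \ e) := hs.diff he
  have hμd : μ (s \ e) ≠ ⊤ := measure_ne_top_of_subset hds hμs
  have hF : μ.real (s \ e) = μ.real s - μ.real e := measureReal_sdiff hes he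
    hμs
  have hFd : 0 ≤ μ.real s - μ.real e := hF ▸ measureReal_nonneg
  have hsplit : ∀ {f : α → ℝ}, IntegrableOn f s μ →
      ∫ x in s, f x ∂μ = ∫ x in e, f x ∂μ + ∫ x in s \ e, f x ∂μ := fun {f} hf => by
    have := setIntegral_sdiff he hf hes
    linarith
  have hgd : ∫ x in s \ e, g x ∂μ ≤ (l * t) ^ (-r) * (μ.real s - μ.real e) := by
    calc ∫ x in s \ e, g x ∂μ ≤ ∫ x in s \ e, (l * t) ^ (-r) ∂μ := by
          refine setIntegral_mono_on_ae (hg.mono_set hds) (integrableOn_const hμd) hd ?_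
          filter_upwards [hgw, h4] with x hx hx4 hxd
          exact hx.trans (Real.rpow_le_rpow_of_nonpos (by positivity) (hx4 hxd.1 hxd.2)
            (by linarith))
      _ = _ := by rw [setIntegral_const, hF, smul_eq_mul, mul_comm]
  have hkd : p * (t * Y) ^ (p - 1) * (t * μ.real s - l * t * μ.real e)
      - (p - 1) * (t * Y) ^ p * (μ.real s - μ.real e) ≤ ∫ x in s \ e, w x ^ p ∂μ := by
    have hwd := hw.mono_set hds
    calc _ = ∫ x in s \ e, (p * (t * Y) ^ (p - 1) * w x - (p - 1) * (t * Y) ^ p) ∂μ := by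
          rw [integral_sub (hwd.const_mul _) (integrableOn_const hμd), integral_const_mul,
            setIntegral_const, hF, smul_eq_mul, setIntegral_sdiff he hw hes, h1, h2]
          ring
      _ ≤ _ := by
          refine setIntegral_mono_on_ae ((hwd.const_mul _).sub (integrableOn_const hμd))
            (hwp.mono_set hds) hd ?_
          filter_upwards [hw0] with x hx _
          exact mul_rpow_sub_le_rpow hp.le hx.le (by positivity)
  have eg := hsplit hg
  have ek := hsplit hwp
  rw [Real.mul_rpow hl.le ht.le] at hgd h3
  rw [Real.mul_rpow hl.le ht.le, Real.mul_rpow hl.le ht.le] at h5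
  rw [Real.mul_rpow ht.le hY.le, Real.mul_rpow ht.le hY.le] at hkd
  have et : t ^ p = t ^ (p - 1) * t := by
    rw [← Real.rpow_add_one ht.ne']; ring_nf
  have eσ := rpow_neg_add_mul_rpow ht p r
  have hσ : 0 < t ^ (-p - r) := by positivity
  have hτ : 0 < t ^ (-r) := by positivity
  have hlpr : 1 ≤ l ^ (-p - r) :=
    Real.one_le_rpow_of_pos_of_le_one_of_nonpos hl hl1.le (by linarith)
  have hf0 : 0 ≤ μ.real e := measureReal_nonneg
  generalize t ^ (-p - r) = σ at *
  generalize t ^ (-r) = τ at *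
  have h3' : B * (l ^ (-p - r) - 1) * (σ * ∫ x in e, w x ^ p ∂μ)
      ≤ B * (l ^ (-p - r) - 1) * (K * l ^ p * τ * μ.real e) := by
    refine mul_le_mul_of_nonneg_left ?_ (mul_nonneg hB (by linarith))
    calc _ ≤ σ * (K * (l ^ p * t ^ p) * μ.real e) := mul_le_mul_of_nonneg_left h3 hσ.le
      _ = _ := by rw [← eσ]; ring
  have hkd' : B * τ * (p * Y ^ (p - 1) * (μ.real s - l * μ.real e)
      - (p - 1) * Y ^ p * (μ.real s - μ.real e)) ≤ B * σ * ∫ x in s \ e, w x ^ p ∂μ := by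
    calc _ = B * σ * (p * (t ^ (p - 1) * Y ^ (p - 1)) * (t * μ.real s - l * t * μ.real e)
      - (p - 1) * (t ^ p * Y ^ p) * (μ.real s - μ.real e)) := by rw [← eσ, et]; ring
      _ ≤ _ := mul_le_mul_of_nonneg_left hkd (mul_nonneg hB hσ.le)
  have i1 := mul_le_mul_of_nonneg_left hA (mul_nonneg hτ.le hFd)
  have i2 := mul_le_mul_of_nonneg_left hA' (mul_nonneg hτ.le hf0)
  rw [eg, ek]
  linarith

/-- The possibly empty open box with opposite corners `a` and `b`. -/
def openBox {n : ℕ} (a b : Fin n → ℝ) : Set (Fin n → ℝ) :=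
  univ.pi fun i => Ioo (a i) (b i)

theorem measurableSet_openBox {n : ℕ} (a b : Fin n → ℝ) : MeasurableSet (openBox a b) :=
  MeasurableSet.univ_pi fun _ => measurableSet_Ioo

theorem mem_openBox {n : ℕ} {a b x : Fin n → ℝ} :
    x ∈ openBox a b ↔ ∀ i, a i < x i ∧ x i < b i := by
  simp [openBox]

theorem isBox_openBox {n : ℕ} {a b : Fin n → ℝ} (h : (openBox a b).Nonempty) :
    IsBox (openBox a b) := by
  obtain ⟨x, hx⟩ := h
  exact ⟨a, b, fun i => (mem_openBox.1 hx i).1.trans (mem_openBox.1 hx i).2, rfl⟩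

theorem exists_balanced_cut {H : ℝ → ℝ} {a b m : ℝ} (hH : Continuous H) (ham : a ≤ m)
    (hmb : m ≤ b) (ha : H a = 0) (hb : 0 ≤ H b) :
    ∃ c d, a ≤ c ∧ c ≤ m ∧ m ≤ d ∧ d ≤ b ∧ H c = H d ∧ 0 ≤ H c ∧ H c ≤ H b := by
  rcases lt_or_ge (H m) 0 with h | h
  · obtain ⟨d, hd, hd0⟩ := intermediate_value_Icc hmb hH.continuousOn ⟨h.le, hb⟩
    exact ⟨a, d, le_rfl, ham, hd.1, hd.2, by rw [ha, hd0], ha.ge, by rwa [ha]⟩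
  rcases le_or_gt (H m) (H b) with h' | h'
  · exact ⟨m, m, ham, le_rfl, le_rfl, hmb, rfl, h, h'⟩
  · obtain ⟨c, hc, hcb⟩ := intermediate_value_Icc ham hH.continuousOn ⟨ha.le.trans hb, h'.le⟩
    exact ⟨c, b, hc.1, hc.2, hmb, le_rfl, hcb, hcb ▸ hb, hcb.le⟩

theorem continuous_setIntegral_inter_coord_lt {n : ℕ} {μ : Measure (Fin n → ℝ)}
    (hμ : NullHyperplanes μ) {f : (Fin n → ℝ) → ℝ} {s : Set (Fin n → ℝ)}
    (hf : IntegrableOn f s μ) (i : Fin n) :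
    Continuous fun c => ∫ x in s ∩ {x | x i < c}, f x ∂μ := by
  have hm : ∀ c : ℝ, MeasurableSet {x : Fin n → ℝ | x i < c} := fun c =>
    measurableSet_lt (measurable_pi_apply i) measurable_const
  have he : ∀ c, ∫ x in s ∩ {x | x i < c}, f x ∂μ
      = ∫ x in s, {x : Fin n → ℝ | x i < c}.indicator f x ∂μ := fun c => by
    rw [setIntegral_indicator (hm c)]
  simp only [he]
  rw [continuous_iff_continuousAt]
  intro c
  refine continuousAt_of_dominated (bound := fun x => ‖f x‖)
    (.of_forall fun d => (hf.indicator (hm d)).aestronglyMeasurable)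
    (.of_forall fun d => .of_forall fun x => norm_indicator_le_norm_self f x) hf.norm ?_
  have h0 : ∀ᵐ x ∂μ, x i ≠ c := by simpa [ae_iff] using hμ i c
  filter_upwards [ae_restrict_of_ae h0] with x hx
  rcases lt_or_gt_of_ne hx with h | h
  · refine (continuousAt_const (y := f x)).congr ?_
    filter_upwards [lt_mem_nhds h] with d hd
    simp [hd]
  · refine (continuousAt_const (y := (0:ℝ))).congr ?_
    filter_upwards [gt_mem_nhds h] with d hd
    simp [hd.le]

/-- Cutting a box with nonnegative integral into two boxes with nonnegative integral, of at most
half the width, and a box with integral zero in between. -/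
theorem exists_box_cut {n : ℕ} {μ : Measure (Fin n → ℝ)}
    (hμ : NullHyperplanes μ) {f : (Fin n → ℝ) → ℝ} {a b : Fin n → ℝ}
    (hf : IntegrableOn f (openBox a b) μ) (h0 : 0 ≤ ∫ x in openBox a b, f x ∂μ) (i : Fin n)
    (hab : a i ≤ b i) :
    ∃ c d, a i ≤ c ∧ c ≤ d ∧ d ≤ b i ∧ c ≤ (a i + b i) / 2 ∧ (a i + b i) / 2 ≤ d ∧
      0 ≤ ∫ x in openBox a b ∩ {x | x i < c}, f x ∂μ ∧
      0 ≤ ∫ x in openBox a b ∩ {x | d < x i}, f x ∂μ ∧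
      ∫ x in openBox a b ∩ {x | c < x i} ∩ {x | x i < d}, f x ∂μ = 0 := by
  set s := openBox a b with hs
  have hH := continuous_setIntegral_inter_coord_lt hμ hf i
  have hme : ∀ c : ℝ, MeasurableSet {x : Fin n → ℝ | x i < c} := fun c =>
    measurableSet_lt (measurable_pi_apply i) measurable_const
  have hae : ∀ c : ℝ, ∀ᵐ x ∂μ, x i ≠ c := fun c => by simpa [ae_iff] using hμ i c
  have ea : s ∩ {x | x i < a i} = ∅ := by
    ext x
    simp only [hs, mem_inter_iff, mem_openBox, mem_ofPred_eq, mem_empty_iff_false, iff_false,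
      not_and, not_lt]
    exact fun h => (h i).1.le
  have eb : s ∩ {x | x i < b i} = s :=
    inter_eq_left.2 fun x hx => (mem_openBox.1 hx i).2
  obtain ⟨c, d, hac, hcm, hmd, hdb, h1, h2, h3⟩ :=
    exists_balanced_cut hH (a := a i) (b := b i) (m := (a i + b i) / 2) (by linarith) (by linarith)
      (by simp [ea]) (by simpa [eb] using h0)
  rw [eb] at h3
  have hsplit : ∀ (c : ℝ) (u : Set (Fin n → ℝ)), IntegrableOn f u μ →
      ∫ x in u ∩ {x | x i < c}, f x ∂μ + ∫ x in u ∩ {x | c < x i}, f x ∂μ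
        = ∫ x in u, f x ∂μ := by
    intro c u hu
    rw [← integral_inter_add_sdiff (hme c) hu]
    congr 1
    refine setIntegral_congr_set ?_
    filter_upwards [hae c] with x hx
    refine propext (and_congr_right fun _ => ?_)
    change c < x i ↔ ¬ x i < c
    rw [not_lt]
    exact ⟨le_of_lt, fun h => lt_of_le_of_ne h (Ne.symm hx)⟩
  have hd := hsplit d s hf
  have hc := hsplit c (s ∩ {x | x i < d}) (hf.mono_set inter_subset_left)
  have e1 : s ∩ {x | x i < d} ∩ {x | x i < c} = s ∩ {x | x i < c} := by
    ext x
    simp only [mem_inter_iff, mem_ofPred_eq]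
    exact ⟨fun h => ⟨h.1.1, h.2⟩, fun h => ⟨⟨h.1, h.2.trans_le (hcm.trans hmd)⟩, h.2⟩⟩
  rw [e1, inter_right_comm] at hc
  exact ⟨c, d, hac, hcm.trans hmd, hdb, hcm, hmd, h2, by linarith, by linarith⟩

theorem openBox_inter_lt {n : ℕ} {a b : Fin n → ℝ} {i : Fin n} {c : ℝ} (hc : c ≤ b i) :
    openBox a b ∩ {x | x i < c} = openBox a (Function.update b i c) := by
  ext x
  simp only [mem_inter_iff, mem_openBox, mem_ofPred_eq]
  constructor
  · rintro ⟨h, h'⟩ j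
    rcases eq_or_ne j i with rfl | hj
    · simpa using ⟨(h j).1, h'⟩
    · simpa [hj] using h j
  · intro h
    have hi : x i < c := by simpa using (h i).2
    refine ⟨fun j => ?_, hi⟩
    rcases eq_or_ne j i with rfl | hj
    · exact ⟨(h j).1, hi.trans_le hc⟩
    · simpa [hj] using h j

theorem openBox_inter_gt {n : ℕ} {a b : Fin n → ℝ} {i : Fin n} {c : ℝ} (hc : a i ≤ c) :
    openBox a b ∩ {x | c < x i} = openBox (Function.update a i c) b := by
  ext x
  simp only [mem_inter_iff, mem_openBox, mem_ofPred_eq]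
  constructor
  · rintro ⟨h, h'⟩ j
    rcases eq_or_ne j i with rfl | hj
    · simpa using ⟨h', (h j).2⟩
    · simpa [hj] using h j
  · intro h
    have hi : c < x i := by simpa using (h i).1
    refine ⟨fun j => ?_, hi⟩
    rcases eq_or_ne j i with rfl | hj
    · exact ⟨hc.trans_lt hi, (h j).2⟩
    · simpa [hj] using h j

theorem exists_box_split {n : ℕ} {μ : Measure (Fin n → ℝ)}
    (hμ : NullHyperplanes μ) {f : (Fin n → ℝ) → ℝ} {a b : Fin n → ℝ}
    (hf : IntegrableOn f (openBox a b) μ) (h0 : 0 ≤ ∫ x in openBox a b, f x ∂μ) (i : Fin n)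
    (hab : a ≤ b) :
    ∃ (u v : Bool → Fin n → ℝ) (p q : Fin n → ℝ),
      (∀ e, u e ≤ v e ∧ openBox (u e) (v e) ⊆ openBox a b ∧
        0 ≤ ∫ x in openBox (u e) (v e), f x ∂μ ∧
        (∀ j, v e j - u e j ≤ b j - a j) ∧ v e i - u e i ≤ (b i - a i) / 2) ∧
      Disjoint (openBox (u true) (v true)) (openBox (u false) (v false)) ∧
      openBox p q ⊆ openBox a b ∧ ∫ x in openBox p q, f x ∂μ = 0 ∧
      (∀ e, Disjoint (openBox (u e) (v e)) (openBox p q)) ∧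
      ∀ᵐ x ∂μ, x ∈ openBox a b → x ∉ openBox p q → ∃ e, x ∈ openBox (u e) (v e) := by
  obtain ⟨c, d, hac, hcd, hdb, hcm, hmd, h1, h2, h3⟩ := exists_box_cut hμ hf h0 i (hab i)
  have e1 := openBox_inter_lt (a := a) (hcd.trans hdb)
  have e2 := openBox_inter_gt (b := b) (hac.trans hcd)
  have e3 : openBox a b ∩ {x | c < x i} ∩ {x | x i < d}
      = openBox (Function.update a i c) (Function.update b i d) := by
    rw [openBox_inter_gt hac, openBox_inter_lt hdb]
  have hup : ∀ {y z : Fin n → ℝ} {e : ℝ}, y ≤ z → e ≤ z i → ∀ j, Function.update y i e j ≤ z j :=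
    fun {y z e} h h' j => by
      rcases eq_or_ne j i with rfl | hj
      · simpa using h'
      · simpa [hj] using h j
  refine ⟨fun e => bif e then a else Function.update a i d,
    fun e => bif e then Function.update b i c else b, _, _, ?_, ?_,
    (by rw [← e3]; exact inter_subset_left.trans inter_subset_left), (by rw [← e3]; exact h3), ?_, ?_⟩
  · rintro (_ | _)
    · simp only [cond_false, ← e2]
      refine ⟨hup hab hdb, inter_subset_left, h2, fun j => ?_, ?_⟩
      · rcases eq_or_ne j i with rfl | hj
        · simp; linarith
        · simp [hj]
      · simp; linarith
    · simp only [cond_true, ← e1]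
      refine ⟨fun j => ?_, inter_subset_left, h1, fun j => ?_, ?_⟩
      · rcases eq_or_ne j i with rfl | hj
        · simpa using hac
        · simpa [hj] using hab j
      · rcases eq_or_ne j i with rfl | hj
        · simp; linarith
        · simp [hj]
      · simp; linarith
  · simp only [cond_true, cond_false, ← e1, ← e2]
    rw [Set.disjoint_left]
    exact fun x hx hx' => lt_asymm (hx.2.trans_le hcd) hx'.2
  · rintro (_ | _)
    · simp only [cond_false, ← e2, ← e3]
      rw [Set.disjoint_left]
      exact fun x hx hx' => lt_asymm (show d < x i from hx.2) hx'.2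
    · simp only [cond_true, ← e1, ← e3]
      rw [Set.disjoint_left]
      exact fun x hx hx' => lt_asymm (show x i < c from hx.2) hx'.1.2
  · have hae : ∀ c : ℝ, ∀ᵐ x ∂μ, x i ≠ c := fun c => by simpa [ae_iff] using hμ i c
    filter_upwards [hae c, hae d] with x hxc hxd hx hx'
    rw [← e3] at hx'
    rcases lt_or_gt_of_ne hxc with h | h
    · exact ⟨true, by simpa only [cond_true, ← e1] using ⟨hx, h⟩⟩
    · rcases lt_or_gt_of_ne hxd with h' | h'
      · exact absurd ⟨⟨hx, h⟩, h'⟩ hx'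
      · exact ⟨false, by simpa only [cond_false, ← e2] using ⟨hx, h'⟩⟩

/-- Iterating the box cut along a sequence of coordinates: `T l` are the boxes that are still to be
cut, `openBox (S l).1 (S l).2` the boxes with integral zero that are removed. -/
theorem exists_stopping_tree {n : ℕ} {μ : Measure (Fin n → ℝ)}
    (hμ : NullHyperplanes μ) {f : (Fin n → ℝ) → ℝ} {a b : Fin n → ℝ}
    (hf : IntegrableOn f (openBox a b) μ) (h0 : 0 ≤ ∫ x in openBox a b, f x ∂μ)
    (hab : a ≤ b) (c : ℕ → Fin n) :
    ∃ (T : List Bool → Set (Fin n → ℝ)) (S : List Bool → (Fin n → ℝ) × (Fin n → ℝ)),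
      (∀ l, MeasurableSet (T l) ∧ T l ⊆ openBox a b ∧ 0 ≤ ∫ x in T l, f x ∂μ) ∧
      (∀ l l', l.length = l'.length → l ≠ l' → Disjoint (T l) (T l')) ∧
      (∀ l, ∀ x ∈ T l, ∀ y ∈ T l, ∀ j,
        |x j - y j| ≤ (b j - a j) * (1 / 2) ^ Nat.count (fun k => c k = j) l.length) ∧
      (∀ l, openBox (S l).1 (S l).2 ⊆ openBox a b ∧
        ∫ x in openBox (S l).1 (S l).2, f x ∂μ = 0) ∧
      Pairwise (fun l l' => Disjoint (openBox (S l).1 (S l).2) (openBox (S l').1 (S l').2)) ∧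
      ∀ᵐ x ∂μ, x ∈ openBox a b → (∀ l, x ∉ openBox (S l).1 (S l).2) →
        ∀ m, ∃ l, l.length = m ∧ x ∈ T l := by
  let P := {z : (Fin n → ℝ) × (Fin n → ℝ) // z.1 ≤ z.2 ∧ openBox z.1 z.2 ⊆ openBox a b ∧
    0 ≤ ∫ x in openBox z.1 z.2, f x ∂μ}
  choose u v p q hlive hdisj hsub hzero hdisj' hcover using fun (z : P) (i : Fin n) =>
    exists_box_split hμ (hf.mono_set z.2.2.1) z.2.2.2 i z.2.1
  let next : P → Fin n → Bool → P := fun z i e => ⟨(u z i e, v z i e), (hlive z i e).1,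
    (hlive z i e).2.1.trans z.2.2.1, (hlive z i e).2.2.1⟩
  let N : List Bool → P := fun l =>
    List.rec ⟨(a, b), hab, Subset.rfl, h0⟩ (fun e l ih => next ih (c l.length) e) l
  let T : List Bool → Set (Fin n → ℝ) := fun l => openBox (N l).1.1 (N l).1.2
  let S : List Bool → (Fin n → ℝ) × (Fin n → ℝ) := fun l =>
    (p (N l) (c l.length), q (N l) (c l.length))
  have hTsub : ∀ e l, T (e :: l) ⊆ T l := fun e l => (hlive (N l) (c l.length) e).2.1
  have hSsub : ∀ l, openBox (S l).1 (S l).2 ⊆ T l := fun l => hsub _ _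
  have hT : ∀ l l', l.length = l'.length → l ≠ l' → Disjoint (T l) (T l') := by
    intro l
    induction l with
    | nil =>
      intro l' h h'
      exact absurd (List.length_eq_zero_iff.1 h.symm).symm h'
    | cons e l ih =>
      rintro (_ | ⟨e', l'⟩) h h'
      · simp at h
      have h : l.length = l'.length := by simpa using h
      by_cases hl : l = l'
      · subst hl
        have : Disjoint (T (true :: l)) (T (false :: l)) := hdisj (N l) (c l.length)
        rcases e with _ | _ <;> rcases e' with _ | _
        · exact absurd rfl h'
        · exact this.symm
        · exact this
        · exact absurd rfl h'
      · exact (ih l' h hl).mono (hTsub _ _) (hTsub _ _)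
  have hST : ∀ l l', l.length < l'.length → Disjoint (openBox (S l).1 (S l).2) (T l') := by
    intro l l'
    induction l' with
    | nil => simp
    | cons e l' ih =>
      intro h
      rcases (Nat.lt_succ_iff.1 h).lt_or_eq with h | h
      · exact (ih h).mono_right (hTsub _ _)
      · by_cases hl : l = l'
        · subst hl
          exact (hdisj' (N l) (c l.length) e).symm
        · exact (hT l l' h hl).mono (hSsub _) (hTsub _ _)
  have hwidth : ∀ l j, (N l).1.2 j - (N l).1.1 j
      ≤ (b j - a j) * (1 / 2) ^ Nat.count (fun k => c k = j) l.length := by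
    intro l j
    induction l with
    | nil => simp [N]
    | cons e l ih =>
      have h1 := (hlive (N l) (c l.length) e).2.2.2
      rw [List.length_cons, Nat.count_succ]
      split_ifs with h
      · subst h
        rw [pow_succ, ← mul_assoc]
        exact h1.2.trans (by linarith)
      · exact (h1.1 j).trans ih
  refine ⟨T, S, fun l => ⟨measurableSet_openBox _ _, (N l).2.2.1, (N l).2.2.2⟩, hT, ?_,
    fun l => ⟨(hSsub l).trans (N l).2.2.1, hzero _ _⟩, ?_, ?_⟩
  · intro l x hx y hy j
    refine le_trans ?_ (hwidth l j)
    have hx := mem_openBox.1 hx j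
    have hy := mem_openBox.1 hy j
    rw [abs_le]
    constructor <;> linarith [hx.1, hx.2, hy.1, hy.2]
  · intro l l' h
    rcases lt_trichotomy l.length l'.length with hl | hl | hl
    · exact (hST l l' hl).mono_right (hSsub _)
    · exact (hT l l' hl h).mono (hSsub _) (hSsub _)
    · exact ((hST l' l hl).mono_right (hSsub _)).symm
  · filter_upwards [ae_all_iff.2 fun l => hcover (N l) (c l.length)] with x hx hxs hxS m
    induction m with
    | zero => exact ⟨[], rfl, hxs⟩
    | succ m ih =>
      obtain ⟨l, hl, hxl⟩ := ih
      obtain ⟨e, he⟩ := hx l hxl (hxS l)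
      exact ⟨e :: l, by simp [hl], he⟩

theorem setIntegral_iUnion_nonneg {α ι : Type*} [MeasurableSpace α] {μ : Measure α} [Countable ι]
    {s : ι → Set α} {f : α → ℝ} (hs : ∀ i, MeasurableSet (s i))
    (hd : Pairwise fun i j => Disjoint (s i) (s j)) (hf : IntegrableOn f (⋃ i, s i) μ)
    (h : ∀ i, 0 ≤ ∫ x in s i, f x ∂μ) : 0 ≤ ∫ x in ⋃ i, s i, f x ∂μ := by
  rw [integral_iUnion hs hd hf]
  exact tsum_nonneg h

/-- A rising sun lemma for boxes: if `∫ f ≥ 0` over a box, then `f ≥ 0` almost everywhere off a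
countable disjoint family of boxes over each of which `∫ f = 0`. -/
theorem exists_rising_sun {n : ℕ} (hn : 1 ≤ n) {μ : Measure (Fin n → ℝ)}
    [IsLocallyFiniteMeasure μ]
    (hμ : NullHyperplanes μ) {f : (Fin n → ℝ) → ℝ} (hfm : Measurable f) {a b : Fin n → ℝ}
    (hf : IntegrableOn f (openBox a b) μ) (h0 : 0 ≤ ∫ x in openBox a b, f x ∂μ) (hab : a ≤ b) :
    ∃ S : List Bool → (Fin n → ℝ) × (Fin n → ℝ),
      (∀ l, openBox (S l).1 (S l).2 ⊆ openBox a b ∧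
        ∫ x in openBox (S l).1 (S l).2, f x ∂μ = 0) ∧
      Pairwise (fun l l' => Disjoint (openBox (S l).1 (S l).2) (openBox (S l').1 (S l').2)) ∧
      ∀ᵐ x ∂μ, x ∈ openBox a b → x ∉ ⋃ l, openBox (S l).1 (S l).2 → 0 ≤ f x := by
  let c : ℕ → Fin n := fun k => ⟨k % n, Nat.mod_lt _ hn⟩
  obtain ⟨T, S, hT, hTd, hTw, hS, hSd, hcover⟩ := exists_stopping_tree hμ hf h0 hab c
  have hcount : ∀ j, Tendsto (fun m => (b j - a j) * (1 / 2 : ℝ) ^ Nat.count (fun k => c k = j) m)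
      atTop (nhds 0) := by
    intro j
    have hinf : {k | c k = j}.Infinite := by
      refine Set.infinite_of_forall_exists_gt fun m => ⟨n * (m + 1) + j, ?_, ?_⟩
      · ext
        simp [c, Nat.mod_eq_of_lt j.2]
      · nlinarith
    have h1 : Tendsto (Nat.count (fun k => c k = j)) atTop atTop :=
      tendsto_atTop_atTop_of_monotone (Nat.count_monotone _) fun m =>
        ⟨Nat.nth (fun k => c k = j) m, (Nat.count_nth_of_infinite hinf m).ge⟩
    simpa using ((tendsto_pow_atTop_nhds_zero_of_lt_one (r := (1 / 2 : ℝ)) (by norm_num)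
      (by norm_num)).comp h1).const_mul (b j - a j)
  refine ⟨S, hS, hSd, ?_⟩
  have hSm : MeasurableSet (⋃ l, openBox (S l).1 (S l).2) :=
    MeasurableSet.iUnion fun l => measurableSet_openBox _ _
  have hAm : MeasurableSet ((openBox a b \ ⋃ l, openBox (S l).1 (S l).2) ∩ {x | f x < 0}) :=
    ((measurableSet_openBox a b).diff hSm).inter (measurableSet_lt hfm measurable_const)
  suffices h : μ ((openBox a b \ ⋃ l, openBox (S l).1 (S l).2) ∩ {x | f x < 0}) = 0 by
    filter_upwards [measure_eq_zero_iff_ae_notMem.1 h] with x hx hxa hxS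
    exact not_lt.1 fun hlt => hx ⟨⟨hxa, hxS⟩, hlt⟩
  rw [hAm.measure_eq_iSup_isCompact]
  simp only [ENNReal.iSup_eq_zero]
  intro K hKA hK
  let I : ℕ → Set (List Bool) := fun m => {l | l.length = m ∧ (T l ∩ K).Nonempty}
  let U : ℕ → Set (Fin n → ℝ) := fun m => ⋃ l : I m, T l
  have hUm : ∀ m, MeasurableSet (U m) := fun m => MeasurableSet.iUnion fun l => (hT l).1
  have hUs : ∀ m, U m ⊆ openBox a b := fun m => iUnion_subset fun l => (hT l).2.1
  have hU0 : ∀ m, 0 ≤ ∫ x in U m, f x ∂μ := fun m => by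
    refine setIntegral_iUnion_nonneg (fun l : I m => (hT l).1) (fun l l' hl => ?_)
      (hf.mono_set (hUs m)) fun l => (hT l).2.2
    exact hTd _ _ (l.2.1.trans l'.2.1.symm) fun h => hl (Subtype.ext h)
  have hKs : K ⊆ openBox a b := fun x hx => (hKA hx).1.1
  have hfK : IntegrableOn f K μ := hf.mono_set hKs
  have hlim : Tendsto (fun m => ∫ x in U m, f x ∂μ) atTop (nhds (∫ x in K, f x ∂μ)) := by
    have e : ∀ {V : Set (Fin n → ℝ)}, MeasurableSet V → V ⊆ openBox a b →
        ∫ x in V, f x ∂μ = ∫ x in openBox a b, V.indicator f x ∂μ := fun {V} hV hVs => by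
      rw [setIntegral_indicator hV, inter_eq_right.2 hVs]
    simp only [fun m => e (hUm m) (hUs m), e hK.measurableSet hKs]
    refine tendsto_integral_of_dominated_convergence (fun x => ‖f x‖)
      (fun m => (hf.indicator (hUm m)).aestronglyMeasurable) hf.norm
      (fun m => .of_forall fun x => norm_indicator_le_norm_self f x) ?_
    filter_upwards [ae_restrict_of_ae hcover] with x hx
    refine tendsto_const_nhds.congr' ?_
    by_cases hxK : x ∈ K
    · refine .of_forall fun m => ?_
      obtain ⟨l, hl, hxl⟩ := hx (hKA hxK).1.1 (by simpa using (hKA hxK).1.2) m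
      have : x ∈ U m := mem_iUnion.2 ⟨⟨l, hl, x, hxl, hxK⟩, hxl⟩
      simp [hxK, this]
    · obtain ⟨ε, hε, hball⟩ := Metric.isOpen_iff.1 hK.isClosed.isOpen_compl x hxK
      filter_upwards [eventually_all.2 fun j => (hcount j).eventually (gt_mem_nhds hε)] with m hm
      have : x ∉ U m := by
        rintro hxU
        obtain ⟨⟨l, rfl, y, hyl, hyK⟩, hxl⟩ := mem_iUnion.1 hxU
        refine hball ?_ hyK
        rw [Metric.mem_ball, dist_pi_lt_iff hε]
        intro j
        rw [Real.dist_eq]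
        exact (hTw l y hyl x hxl j).trans_lt (hm j)
      simp [hxK, this]
  have hK0 : 0 ≤ ∫ x in K, f x ∂μ := ge_of_tendsto' hlim hU0
  by_contra hne
  have hpos : 0 < ∫ x in K, (-f) x ∂μ := by
    rw [setIntegral_pos_iff_support_of_nonneg_ae ?_ hfK.neg]
    · refine (pos_iff_ne_zero.2 hne).trans_le (measure_mono fun x hx => ⟨?_, hx⟩)
      have : f x < 0 := (hKA hx).2
      simp [this.ne]
    · filter_upwards [ae_restrict_mem hK.measurableSet] with x hx
      have : f x < 0 := (hKA hx).2
      simpa using this.le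
  simp only [Pi.neg_apply, integral_neg] at hpos
  linarith

theorem setIntegral_rpow_le_of_RHBound {n : ℕ} {μ : Measure (Fin n → ℝ)} {w : (Fin n → ℝ) → ℝ}
    {p Q t : ℝ} (hp : 1 < p) (hQ : 0 < Q) (ht : 0 < t) (hw0 : ∀ᵐ x ∂μ, 0 < w x)
    (hRH : RHBound μ w p Q) {a b : Fin n → ℝ} (hμ : μ (openBox a b) ≠ ⊤)
    (h : ∫ x in openBox a b, w x ∂μ = t * μ.real (openBox a b)) :
    ∫ x in openBox a b, w x ^ p ∂μ ≤ Q ^ p * t ^ p * μ.real (openBox a b) := by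
  rcases eq_or_ne (μ (openBox a b)) 0 with h0 | h0
  · simp [Measure.real, Measure.restrict_eq_zero.2 h0, h0]
  have hne : (openBox a b).Nonempty := nonempty_of_measure_ne_zero h0
  have hF : 0 < μ.real (openBox a b) := ENNReal.toReal_pos h0 hμ
  obtain ⟨-, -, hb⟩ := hRH _ (isBox_openBox hne) (pos_iff_ne_zero.2 h0) hμ.lt_top
  have hk0 : 0 ≤ ∫ x in openBox a b, w x ^ p ∂μ := by
    refine integral_nonneg_of_ae (ae_restrict_of_ae ?_)
    filter_upwards [hw0] with x hx
    exact Real.rpow_nonneg hx.le _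
  simp only [boxAvg, setAverage_eq, smul_eq_mul, h] at hb
  have e : (μ.real (openBox a b))⁻¹ * (t * μ.real (openBox a b)) = t := by field_simp
  rw [e] at hb
  have h2 := Real.rpow_le_rpow (z := p) (by positivity) hb (by linarith)
  rw [← Real.rpow_mul (by positivity), one_div_mul_cancel (by linarith), Real.rpow_one,
    Real.mul_rpow hQ.le ht.le, inv_mul_le_iff₀ hF] at h2
  linarith

theorem setIntegral_truncated_rpow_le {n : ℕ} (hn : 1 ≤ n) {μ : Measure (Fin n → ℝ)}
    [IsLocallyFiniteMeasure μ] (hμ : NullHyperplanes μ) {w : (Fin n → ℝ) → ℝ} (hwm : Measurable w)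
    (hw0 : ∀ᵐ x ∂μ, 0 < w x) {p Q r l A B Y : ℝ} (hp : 1 < p) (hQ : 0 < Q) (hr : 0 < r)
    (hRH : RHBound μ w p Q) (hl : 0 < l) (hl1 : l < 1) (hB : 0 ≤ B)
    (hY : 0 < Y) (hAB : 1 ≤ A + B)
    (hA : l ^ (-r) ≤ A + B * (p * Y ^ (p - 1) - (p - 1) * Y ^ p))
    (hA' : A * (l ^ (-r) - 1) + B * (l ^ (-p - r) - 1) * (Q ^ p * l ^ p)
      ≤ B * (p * Y ^ (p - 1) * (1 - l)))
    (N : ℕ) : ∀ (a b : Fin n → ℝ) (t : ℝ), 0 < t → μ (openBox a b) ≠ ⊤ →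
      IntegrableOn w (openBox a b) μ → IntegrableOn (fun x => w x ^ p) (openBox a b) μ →
      ∫ x in openBox a b, w x ∂μ = t * μ.real (openBox a b) →
      ∫ x in openBox a b, max (w x) (t * l ^ N) ^ (-r) ∂μ
        ≤ A * t ^ (-r) * μ.real (openBox a b)
          + B * t ^ (-p - r) * ∫ x in openBox a b, w x ^ p ∂μ := by
  have hgm : ∀ {c : ℝ} {a b : Fin n → ℝ}, 0 < c → μ (openBox a b) ≠ ⊤ →
      IntegrableOn (fun x => max (w x) c ^ (-r)) (openBox a b) μ := fun {c a b} hc hfin => by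
    refine Measure.integrableOn_of_bounded hfin
      ((hwm.max measurable_const).pow_const _).aestronglyMeasurable (M := c ^ (-r))
      (.of_forall fun x => ?_)
    have hmax : 0 < max (w x) c := lt_max_of_lt_right hc
    rw [Real.norm_of_nonneg (by positivity)]
    exact Real.rpow_le_rpow_of_nonpos hc (le_max_right _ _) (by linarith)
  induction N with
  | zero =>
    intro a b t ht hfin hw hwp h1
    have hgle : ∫ x in openBox a b, max (w x) (t * l ^ 0) ^ (-r) ∂μ
        ≤ t ^ (-r) * μ.real (openBox a b) := by
      rw [pow_zero, mul_one]
      calc _ ≤ ∫ x in openBox a b, t ^ (-r) ∂μ := by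
            refine setIntegral_mono_on (hgm ht hfin) (integrableOn_const hfin)
              (measurableSet_openBox a b) fun x _ => ?_
            exact Real.rpow_le_rpow_of_nonpos ht (le_max_right _ _) (by linarith)
        _ = _ := by rw [setIntegral_const, smul_eq_mul, mul_comm]
    have hk : t ^ p * μ.real (openBox a b) ≤ ∫ x in openBox a b, w x ^ p ∂μ := by
      have et : t ^ p = t ^ (p - 1) * t := by
        rw [← Real.rpow_add_one ht.ne']; ring_nf
      calc _ = ∫ x in openBox a b, (p * t ^ (p - 1) * w x - (p - 1) * t ^ p) ∂μ := by
            rw [integral_sub (hw.const_mul _) (integrableOn_const hfin), integral_const_mul,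
              setIntegral_const, smul_eq_mul, h1, et]
            ring
        _ ≤ _ := by
            refine setIntegral_mono_on_ae ((hw.const_mul _).sub (integrableOn_const hfin))
              hwp (measurableSet_openBox a b) ?_
            filter_upwards [hw0] with x hx _
            exact mul_rpow_sub_le_rpow hp.le hx.le ht
    have hτ : 0 < t ^ (-r) := by positivity
    have hk' : B * (t ^ (-r) * μ.real (openBox a b))
        ≤ B * t ^ (-p - r) * ∫ x in openBox a b, w x ^ p ∂μ := by
      have hσ : 0 < t ^ (-p - r) := by positivity
      have := mul_le_mul_of_nonneg_left hk (mul_nonneg hB hσ.le)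
      rw [← rpow_neg_add_mul_rpow ht p r]
      linarith
    have hF : 0 ≤ μ.real (openBox a b) := measureReal_nonneg
    have := mul_le_mul_of_nonneg_right hAB (mul_nonneg hτ.le hF)
    linarith
  | succ N ih =>
    intro a b t ht hfin hw hwp h1
    rcases (openBox a b).eq_empty_or_nonempty with hem | ⟨x₀, hx₀⟩
    · simp [hem]
    have hab : a ≤ b := fun i => ((mem_openBox.1 hx₀ i).1.trans (mem_openBox.1 hx₀ i).2).le
    have hF : 0 ≤ μ.real (openBox a b) := measureReal_nonneg
    have hlt : 0 < l * t := mul_pos hl ht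
    obtain ⟨S, hS, hSd, hSae⟩ := exists_rising_sun hn hμ (f := fun x => w x - l * t)
      (hwm.sub_const _) (hw.sub (integrableOn_const hfin)) (by
        rw [integral_sub hw (integrableOn_const hfin), setIntegral_const, smul_eq_mul, h1]
        nlinarith [mul_nonneg (mul_nonneg (sub_nonneg.2 hl1.le) ht.le) hF]) hab
    have hSm : ∀ i, MeasurableSet (openBox (S i).1 (S i).2) := fun i => measurableSet_openBox _ _
    have hE : MeasurableSet (⋃ i, openBox (S i).1 (S i).2) := MeasurableSet.iUnion hSm
    have hEs : (⋃ i, openBox (S i).1 (S i).2) ⊆ openBox a b := iUnion_subset fun i => (hS i).1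
    have hEfin := measure_ne_top_of_subset hEs hfin
    have hSfin : ∀ i, μ (openBox (S i).1 (S i).2) ≠ ⊤ := fun i =>
      measure_ne_top_of_subset (hS i).1 hfin
    have hSw : ∀ i, ∫ x in openBox (S i).1 (S i).2, w x ∂μ
        = l * t * μ.real (openBox (S i).1 (S i).2) := fun i => by
      have := (hS i).2
      rw [integral_sub (hw.mono_set (hS i).1) (integrableOn_const (hSfin i)), setIntegral_const,
        smul_eq_mul] at this
      linarith
    have hc : t * l ^ (N + 1) = l * t * l ^ N := by ring
    have hg := hgm (mul_pos ht (pow_pos hl (N + 1))) hfin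
    refine setIntegral_stopping_step hp hr hl hl1 hB hY ht hA hA' (measurableSet_openBox a b) hE
      hEs hfin hw0 hw hwp hg ?_ h1 ?_ ?_ ?_ ?_
    · filter_upwards [hw0] with x hx
      exact Real.rpow_le_rpow_of_nonpos hx (le_max_left _ _) (by linarith)
    · have h2 := integral_iUnion hSm hSd (hw.mono_set hEs)
      have h3 := integral_iUnion (f := fun _ => l * t) hSm hSd (integrableOn_const hEfin)
      simp only [setIntegral_const, smul_eq_mul] at h3
      rw [h2, mul_comm, h3]
      exact tsum_congr fun i => by rw [hSw i, mul_comm]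
    · have hk : ∀ {u : Set (Fin n → ℝ)}, μ u ≠ ⊤ →
          Integrable (fun _ => Q ^ p * (l * t) ^ p) (μ.restrict u) := fun hu => integrableOn_const hu
      have := setIntegral_iUnion_nonneg hSm hSd
        ((integrableOn_const (C := Q ^ p * (l * t) ^ p) hEfin).sub (hwp.mono_set hEs)) fun i => by
          simp only [Pi.sub_apply]
          rw [integral_sub (hk (hSfin i)) (hwp.mono_set (hS i).1),
            setIntegral_const, smul_eq_mul]
          have := setIntegral_rpow_le_of_RHBound hp hQ hlt hw0 hRH (hSfin i) (hSw i)
          linarith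
      simp only [Pi.sub_apply] at this
      rw [integral_sub (hk hEfin) (hwp.mono_set hEs), setIntegral_const,
        smul_eq_mul] at this
      linarith
    · filter_upwards [hSae] with x hx hxs hxE
      linarith [hx hxs hxE]
    · have hsub : ∀ {u : Set (Fin n → ℝ)}, u ⊆ openBox a b →
          ∫ x in u, (A * (l * t) ^ (-r) + B * (l * t) ^ (-p - r) * w x ^ p
              - max (w x) (t * l ^ (N + 1)) ^ (-r)) ∂μ
            = A * (l * t) ^ (-r) * μ.real u
              + B * (l * t) ^ (-p - r) * ∫ x in u, w x ^ p ∂μ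
              - ∫ x in u, max (w x) (t * l ^ (N + 1)) ^ (-r) ∂μ := fun {u} hu => by
        have hk : Integrable (fun _ => A * (l * t) ^ (-r)) (μ.restrict u) :=
          integrableOn_const (measure_ne_top_of_subset hu hfin)
        have hp' := (hwp.mono_set hu).const_mul (B * (l * t) ^ (-p - r))
        have hadd : Integrable (fun x => A * (l * t) ^ (-r) + B * (l * t) ^ (-p - r) * w x ^ p)
            (μ.restrict u) := hk.add hp'
        rw [integral_sub hadd (hg.mono_set hu), integral_add hk hp', setIntegral_const,
          smul_eq_mul, integral_const_mul]
        ring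
      have := setIntegral_iUnion_nonneg hSm hSd
        (((integrableOn_const (C := A * (l * t) ^ (-r)) hEfin).add
          ((hwp.mono_set hEs).const_mul (B * (l * t) ^ (-p - r)))).sub (hg.mono_set hEs))
        fun i => by
          simp only [Pi.sub_apply, Pi.add_apply]
          rw [hsub (hS i).1, sub_nonneg, hc]
          exact ih _ _ _ hlt (hSfin i) (hw.mono_set (hS i).1) (hwp.mono_set (hS i).1) (hSw i)
      simp only [Pi.sub_apply, Pi.add_apply] at this
      rw [hsub hEs] at this
      linarith

theorem setIntegral_rpow_neg_le {n : ℕ} (hn : 1 ≤ n) {μ : Measure (Fin n → ℝ)}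
    [IsLocallyFiniteMeasure μ] (hμ : NullHyperplanes μ) {w : (Fin n → ℝ) → ℝ} (hwm : Measurable w)
    (hw0 : ∀ᵐ x ∂μ, 0 < w x) {p Q r l A B Y : ℝ} (hp : 1 < p) (hQ : 0 < Q) (hr : 0 < r)
    (hRH : RHBound μ w p Q) (hl : 0 < l) (hl1 : l < 1) (hB : 0 ≤ B)
    (hY : 0 < Y) (hAB : 1 ≤ A + B)
    (hA : l ^ (-r) ≤ A + B * (p * Y ^ (p - 1) - (p - 1) * Y ^ p))
    (hA' : A * (l ^ (-r) - 1) + B * (l ^ (-p - r) - 1) * (Q ^ p * l ^ p)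
      ≤ B * (p * Y ^ (p - 1) * (1 - l)))
    {a b : Fin n → ℝ} {t : ℝ} (ht : 0 < t) (hfin : μ (openBox a b) ≠ ⊤)
    (hw : IntegrableOn w (openBox a b) μ) (hwp : IntegrableOn (fun x => w x ^ p) (openBox a b) μ)
    (h1 : ∫ x in openBox a b, w x ∂μ = t * μ.real (openBox a b)) :
    IntegrableOn (fun x => w x ^ (-r)) (openBox a b) μ ∧
      ∫ x in openBox a b, w x ^ (-r) ∂μ ≤ (A + B * Q ^ p) * t ^ (-r) * μ.real (openBox a b) := by
  have hpos : ∀ N x, 0 < max (w x) (t * l ^ N) := fun N x => lt_max_of_lt_right (by positivity)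
  refine integrable_and_integral_le_of_tendsto (g := fun N x => max (w x) (t * l ^ N) ^ (-r))
    (fun N => ?_) (fun N => .of_forall fun x => Real.rpow_nonneg (hpos N x).le _) (fun N => ?_) ?_
  · refine Measure.integrableOn_of_bounded hfin
      ((hwm.max measurable_const).pow_const _).aestronglyMeasurable (M := (t * l ^ N) ^ (-r))
      (.of_forall fun x => ?_)
    rw [Real.norm_of_nonneg (Real.rpow_nonneg (hpos N x).le _)]
    exact Real.rpow_le_rpow_of_nonpos (by positivity) (le_max_right _ _) (by linarith)
  · refine (setIntegral_truncated_rpow_le hn hμ hwm hw0 hp hQ hr hRH hl hl1 hB hY hAB hA hA' N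
      a b t ht hfin hw hwp h1).trans ?_
    have hk := setIntegral_rpow_le_of_RHBound hp hQ ht hw0 hRH hfin h1
    have hσ : 0 < t ^ (-p - r) := by positivity
    have := mul_le_mul_of_nonneg_left hk (mul_nonneg hB hσ.le)
    rw [← rpow_neg_add_mul_rpow ht p r]
    linarith
  · have hl0 : Tendsto (fun N : ℕ => t * l ^ N) atTop (nhds 0) := by
      simpa using (tendsto_pow_atTop_nhds_zero_of_lt_one hl.le hl1).const_mul t
    filter_upwards [ae_restrict_of_ae hw0] with x hx
    have h2 : Tendsto (fun N : ℕ => max (w x) (t * l ^ N)) atTop (nhds (w x)) := by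
      simpa [max_eq_left hx.le] using (tendsto_const_nhds (x := w x)).max hl0
    exact h2.rpow_const (Or.inl hx.ne')

/-- Self-improvement `RH_p^* ⊂ A_q^*` for `q > 1 - s⁻_p(Q)`, with a
constant independent of the dimension and of the measure. -/
theorem strong_RHp_self_improvement_to_Aq
    (p Q : ℝ) (hp : 1 < p) (hQ : 1 < Q)
    (sm : ℝ) (hsm_mem : sm ∈ Iic (0:ℝ))
    (hsm : (1 - p * sm) ^ (1 / p) * (1 - sm)⁻¹ = 1 / Q)
    (q : ℝ) (hq : 1 - sm < q) :
    ∃ C : ℝ, 0 < C ∧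
      ∀ n : ℕ, 1 ≤ n →
        ∀ μ : Measure (Fin n → ℝ), IsLocallyFiniteMeasure μ → NullHyperplanes μ →
          ∀ w : (Fin n → ℝ) → ℝ, Measurable w → (∀ᵐ x ∂μ, 0 < w x) →
            RHBound μ w p Q → ApBound μ w q C := by
  have hsm0 : sm ≤ 0 := hsm_mem
  have hQ0 : 0 < Q := by linarith
  have hq1 : 0 < q - 1 := by linarith
  have hr : 0 < 1 / (q - 1) := by positivity
  have hps : 0 ≤ 1 - p * sm := by nlinarith
  have hcrit : (1 + -sm) ^ p = Q ^ p * (1 + p * -sm) := by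
    have h1 : 1 + -sm = Q * (1 - p * sm) ^ (1 / p) := by
      have : (1 - sm) ≠ 0 := by linarith
      field_simp at hsm
      linarith
    rw [h1, Real.mul_rpow hQ0.le (Real.rpow_nonneg hps _), ← Real.rpow_mul hps,
      one_div_mul_cancel (by linarith), Real.rpow_one]
    ring
  have hgt := rpow_one_add_gt (a := q - 1) hp (neg_nonneg.2 hsm0) (by linarith)
    (Real.rpow_pos_of_pos hQ0 p) hcrit
  obtain ⟨l, A, B, Y, hl, hl1, hB, hY, hAB, hA, hA'⟩ :=
    exists_coefficients (r := 1 / (q - 1)) hp hr (by rwa [one_div_one_div])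
  have hD : 1 ≤ A + B * Q ^ p := by
    have := mul_le_mul_of_nonneg_left (Real.one_le_rpow hQ.le (by linarith : 0 ≤ p)) hB
    linarith
  refine ⟨(A + B * Q ^ p) ^ (q - 1), by positivity, ?_⟩
  intro n hn μ hμf hμ w hwm hw0 hRH R hR hR0 hRfin
  obtain ⟨hw, hwp, -⟩ := hRH R hR hR0 hRfin
  obtain ⟨a, b, -, rfl⟩ := hR
  change IntegrableOn w (openBox a b) μ at hw
  change IntegrableOn (fun x => w x ^ p) (openBox a b) μ at hwp
  change 0 < μ (openBox a b) at hR0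
  change μ (openBox a b) < ⊤ at hRfin
  change IntegrableOn w (openBox a b) μ ∧
    IntegrableOn (fun x => w x ^ (-1 / (q - 1))) (openBox a b) μ ∧
    boxAvg μ (openBox a b) w * (boxAvg μ (openBox a b) fun x => w x ^ (-1 / (q - 1))) ^ (q - 1) ≤ _
  have hF : 0 < μ.real (openBox a b) := ENNReal.toReal_pos hR0.ne' hRfin.ne
  obtain ⟨t, htd⟩ : ∃ t, t = boxAvg μ (openBox a b) w := ⟨_, rfl⟩
  have h1 : ∫ x in openBox a b, w x ∂μ = t * μ.real (openBox a b) := by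
    rw [htd, boxAvg, setAverage_eq, smul_eq_mul]
    field_simp
  have ht : 0 < t := by
    have h2 : 0 < ∫ x in openBox a b, w x ∂μ := by
      rw [setIntegral_pos_iff_support_of_nonneg_ae
        (ae_restrict_of_ae (hw0.mono fun x hx => hx.le)) hw]
      refine hR0.trans_le (measure_mono_ae ?_)
      filter_upwards [hw0] with x hx hxb
      exact ⟨hx.ne', hxb⟩
    rw [h1] at h2
    exact pos_of_mul_pos_left h2 hF.le
  obtain ⟨hint, hle⟩ := setIntegral_rpow_neg_le hn hμ hwm hw0 hp hQ0 hr hRH hl hl1 hB hY hAB hA hA'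
    ht hRfin.ne hw hwp h1
  rw [← neg_div] at hint hle
  refine ⟨hw, hint, ?_⟩
  have havg : boxAvg μ (openBox a b) (fun x => w x ^ (-1 / (q - 1)))
      ≤ (A + B * Q ^ p) * t ^ (-1 / (q - 1)) := by
    rw [boxAvg, setAverage_eq, smul_eq_mul, inv_mul_le_iff₀ hF]
    linarith
  have hnn : 0 ≤ boxAvg μ (openBox a b) (fun x => w x ^ (-1 / (q - 1))) := by
    rw [boxAvg, setAverage_eq, smul_eq_mul]
    refine mul_nonneg (by positivity) (integral_nonneg_of_ae (ae_restrict_of_ae ?_))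
    filter_upwards [hw0] with x hx
    exact Real.rpow_nonneg hx.le _
  rw [← htd]
  calc _ ≤ t * ((A + B * Q ^ p) * t ^ (-1 / (q - 1))) ^ (q - 1) :=
        mul_le_mul_of_nonneg_left (Real.rpow_le_rpow hnn havg hq1.le) ht.le
    _ = (A + B * Q ^ p) ^ (q - 1) := by
        rw [Real.mul_rpow (by linarith) (by positivity), ← Real.rpow_mul ht.le,
          div_mul_cancel₀ _ hq1.ne', Real.rpow_neg_one]
        field_simp
end
end
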